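/- Let A : Diff_id^1(ℝ³) → 𝓛(V,V*), φ ↦ A_φ, assign to each φ a bounded symmetric nonnegative operator, and suppose φ ↦ A_φ is locally Lipschitz for the ‖·‖_{1,∞} distance: for every φ₀ ∈ Diff_id^1(ℝ³) there exist r > 0 and ℓ > 0 such that ‖A_φ − A_ψ‖_{𝓛(V,V*)} ≤ ℓ‖φ − ψ‖_{1,∞} whenever ‖φ − φ₀‖_{1,∞} ≤ r and ‖ψ − φ₀‖_{1,∞} ≤ r. Then for every T > 0 and every Bochner integrable j ∈ L¹([0,T],V*), the control system φ(t) = id + ∫₀ᵗ v(s) ∘ φ(s) ds with v(s) = (ω K_V⁻¹ + A_{φ(s)})⁻¹ j(s) has a unique solution φ on all of [0,T], and this solution is a continuous map from [0,T] into Diff_id²(ℝ³). -/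

import Mathlib

open MeasureTheory Filter Set
open scoped RealInnerProductSpace Topology

noncomputable section

/-- Euclidean 3-space. -/
abbrev E3 : Type := EuclideanSpace ℝ (Fin 3)

/-- The supremum over `ℝ³` of the norm of the `k`-th derivative of `v`. -/
def supDeriv (k : ℕ) (v : E3 → E3) : ℝ := ⨆ x : E3, ‖iteratedFDeriv ℝ k v x‖

/-- The norm `‖v‖_{s,∞} = Σ_{k ≤ s} sup_x |Dᵏ v(x)|`. -/
def normS (s : ℕ) (v : E3 → E3) : ℝ := ∑ k ∈ Finset.range (s + 1), supDeriv k v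

/-- The seminorm `‖v‖_{1,∞}^Ω = sup_{x ∈ Ω} |v(x)| + sup_{x ∈ Ω} |Dv(x)|`. -/
def normSOn (Ω : Set E3) (v : E3 → E3) : ℝ :=
  (⨆ x : Ω, ‖v (x : E3)‖) + ⨆ x : Ω, ‖fderiv ℝ v (x : E3)‖

/-- Membership in `C₀^s(ℝ³,ℝ³)`: `v` is `C^s` and all derivatives up to order `s`
tend to `0` at infinity. -/
def MemC0 (s : ℕ) (v : E3 → E3) : Prop :=
  ContDiff ℝ s v ∧
    ∀ k ≤ s, Tendsto (fun x => ‖iteratedFDeriv ℝ k v x‖) (cocompact E3) (𝓝 0)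

/-- `Diff_id^s(ℝ³)`: `C^s`-diffeomorphisms of `ℝ³` equal to the identity at infinity. -/
structure DiffId (s : ℕ) : Type where
  toFun : E3 → E3
  invFun : E3 → E3
  left_inv : Function.LeftInverse invFun toFun
  right_inv : Function.RightInverse invFun toFun
  memC0 : MemC0 s fun x => toFun x - x
  memC0_inv : MemC0 s fun x => invFun x - x

instance (s : ℕ) : CoeFun (DiffId s) fun _ => E3 → E3 := ⟨DiffId.toFun⟩

/-- The distance `‖φ − ψ‖_{s,∞}` on `Diff_id^s(ℝ³)`. -/
def distS (s : ℕ) (φ ψ : DiffId s) : ℝ := normS s fun x => φ x - ψ x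

/-- The set `𝔖_γ = {φ : ‖φ − id‖_{1,∞} ≤ γ and ‖φ⁻¹ − id‖_{1,∞} ≤ γ}`. -/
def Sgamma (γ : ℝ) : Set (DiffId 1) :=
  {φ | normS 1 (fun x => φ x - x) ≤ γ ∧ normS 1 (fun x => φ.invFun x - x) ≤ γ}

/-- `v` is the velocity `(ω K_V⁻¹ + B)⁻¹ j`, i.e. the unique minimizer of
`(ω/2)‖·‖² + (1/2)(B · | ·) − (j | ·)`:  `ω⟪v,w⟫ + (Bv|w) = (j|w)` for all `w`. -/
def IsVel {V : Type*} [NormedAddCommGroup V] [InnerProductSpace ℝ V]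
    (B : V →L[ℝ] V →L[ℝ] ℝ) (ω : ℝ) (j : V →L[ℝ] ℝ) (v : V) : Prop :=
  ∀ w : V, ω * ⟪v, w⟫ + B v w = j w

/-- `(φ, v)` solves the control system
`φ(t) = id + ∫₀ᵗ v(s) ∘ φ(s) ds`, `v(s) = (ω K_V⁻¹ + A_{φ(s)})⁻¹ j(s)` on `[0,T₀]`,
with `t ↦ φ(t)` continuous into `Diff_id¹(ℝ³)`. -/
def IsSolution {V : Type*} [NormedAddCommGroup V] [InnerProductSpace ℝ V]
    (emb : V →ₗ[ℝ] (E3 → E3)) (ω : ℝ) (A : DiffId 1 → V →L[ℝ] V →L[ℝ] ℝ)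
    (j : ℝ → V →L[ℝ] ℝ) (T₀ : ℝ) (φ : ℝ → DiffId 1) (v : ℝ → V) : Prop :=
  (∀ t ∈ Icc (0 : ℝ) T₀, IsVel (A (φ t)) ω (j t) (v t)) ∧
  (∀ t ∈ Icc (0 : ℝ) T₀, ∀ x : E3,
    IntervalIntegrable (fun s => emb (v s) (φ s x)) volume 0 t ∧
      φ t x = x + ∫ s in (0 : ℝ)..t, emb (v s) (φ s x)) ∧
  ∀ t₀ ∈ Icc (0 : ℝ) T₀,
    Tendsto (fun t => distS 1 (φ t) (φ t₀)) (𝓝[Icc (0 : ℝ) T₀] t₀) (𝓝 0)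

section
set_option maxSynthPendingDepth 3
set_option linter.unusedSectionVars false
namespace FY

lemma cont_prim {Y : Type*} [NormedAddCommGroup Y] [NormedSpace ℝ Y]
    {h : ℝ → Y} (hh : Integrable h) : Continuous fun t => ∫ s in Iic t, h s := by
  have : (fun t => ∫ s in Iic t, h s) = fun t => (∫ s in Iic 0, h s) + ∫ s in (0:ℝ)..t, h s := by
    ext t
    rw [← intervalIntegral.integral_Iic_sub_Iic hh.integrableOn hh.integrableOn]
    abel
  rw [this]
  exact continuous_const.add (intervalIntegral.continuous_primitive
    (fun a b => hh.intervalIntegrable) 0)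

lemma prim_mono {k : ℝ → ℝ} (hk : Integrable k) (hk0 : ∀ s, 0 ≤ k s) :
    Monotone fun t => ∫ s in Iic t, k s := by
  intro a b hab
  exact setIntegral_mono_set hk.integrableOn (Eventually.of_forall hk0)
    (Iic_subset_Iic.2 hab).eventuallyLE

lemma prim_le {k : ℝ → ℝ} (hk : Integrable k) (hk0 : ∀ s, 0 ≤ k s) (t : ℝ) :
    ∫ s in Iic t, k s ≤ ∫ s, k s :=
  setIntegral_le_integral hk (Eventually.of_forall hk0)

lemma prim_nonneg {k : ℝ → ℝ} (hk0 : ∀ s, 0 ≤ k s) (t : ℝ) :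
    0 ≤ ∫ s in Iic t, k s := integral_nonneg hk0

/-- the weight -/
def W (k : ℝ → ℝ) (t : ℝ) : ℝ := Real.exp (2 * ∫ s in Iic t, k s)

lemma W_cont {k : ℝ → ℝ} (hk : Integrable k) : Continuous (W k) :=
  Real.continuous_exp.comp (continuous_const.mul (cont_prim hk))

lemma W_one_le {k : ℝ → ℝ} (hk0 : ∀ s, 0 ≤ k s) (t : ℝ) : 1 ≤ W k t :=
  Real.one_le_exp (mul_nonneg zero_le_two (prim_nonneg hk0 t))

lemma W_le {k : ℝ → ℝ} (hk : Integrable k) (hk0 : ∀ s, 0 ≤ k s) (t : ℝ) :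
    W k t ≤ Real.exp (2 * ∫ s, k s) :=
  Real.exp_le_exp.2 (mul_le_mul_of_nonneg_left (prim_le hk hk0 t) zero_le_two)

lemma W_pos (k : ℝ → ℝ) (t : ℝ) : 0 < W k t := Real.exp_pos _

lemma kW_int {k : ℝ → ℝ} (hk : Integrable k) (hk0 : ∀ s, 0 ≤ k s) :
    Integrable fun s => k s * W k s := by
  refine hk.mul_bdd (c := Real.exp (2 * ∫ s, k s)) (W_cont hk).aestronglyMeasurable ?_
  refine Eventually.of_forall fun s => ?_
  rw [Real.norm_of_nonneg (W_pos k s).le]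
  exact W_le hk hk0 s

lemma weight_ineq {k : ℝ → ℝ} (hk : Integrable k) (hk0 : ∀ s, 0 ≤ k s) (t : ℝ) :
    ∫ s in Iic t, k s * W k s ≤ W k t / 2 := by
  have h1 := intervalIntegral_tendsto_integral_Iic (μ := volume) (l := atBot) (a := id)
    t (kW_int hk hk0).integrableOn tendsto_id
  refine le_of_tendsto h1 ?_
  filter_upwards [eventually_le_atBot t] with a ha
  simp only [id]
  have hmono : Monotone (W k) := fun a b hab => Real.exp_le_exp.2
    (mul_le_mul_of_nonneg_left (prim_mono hk hk0 hab) zero_le_two)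
  have h2 := (hmono.monotoneOn (uIcc a t)).intervalIntegral_deriv_mem_uIcc
  rw [uIcc_of_le (sub_nonneg.2 (hmono ha))] at h2
  have h3 : ∀ᵐ s, deriv (W k) s = 2 * (k s * W k s) := by
    filter_upwards [LocallyIntegrable.ae_hasDerivAt_integral hk.locallyIntegrable] with s hs
    have h4 : HasDerivAt (fun t => ∫ s in Iic t, k s) (k s) s := by
      have : (fun t => ∫ s in Iic t, k s)
          = fun t => (∫ s in Iic 0, k s) + ∫ s in (0:ℝ)..t, k s := by
        ext t
        rw [← intervalIntegral.integral_Iic_sub_Iic hk.integrableOn hk.integrableOn]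
        abel
      rw [this]
      exact (hs 0).const_add _
    have h5 := ((h4.const_mul 2).exp).deriv
    change deriv (W k) s = _ at h5
    rw [h5]
    simp only [W]; ring
  have h6 : ∫ s in a..t, deriv (W k) s = 2 * ∫ s in a..t, k s * W k s := by
    rw [← intervalIntegral.integral_const_mul]
    exact intervalIntegral.integral_congr_ae (h3.mono fun s hs _ => hs)
  rw [h6] at h2
  have := h2.2
  have := W_pos k a
  linarith

/-- Gronwall constant -/
def GC (k : ℝ → ℝ) : ℝ := 2 * Real.exp (2 * ∫ s, k s)

lemma GC_nonneg (k : ℝ → ℝ) : 0 ≤ GC k := by unfold GC; positivity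

lemma gronwall {k f : ℝ → ℝ} (hk : Integrable k) (hk0 : ∀ s, 0 ≤ k s) {a B t0 : ℝ}
    (ha : 0 ≤ a) (hf0 : ∀ t, 0 ≤ f t) (hfB : ∀ t, f t ≤ B)
    (h : ∀ t ≤ t0, f t ≤ a + ∫ s in Iic t, k s * f s) : f t0 ≤ GC k * a := by
  have hB : 0 ≤ B := (hf0 0).trans (hfB 0)
  have key : ∀ n : ℕ, ∀ t ≤ t0, f t ≤ (2 * a + B * (1/2)^n) * W k t := by
    intro n
    induction n with
    | zero =>
      intro t _
      have h1 := W_one_le hk0 t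
      have h2 := hfB t
      simp only [pow_zero, mul_one]
      nlinarith
    | succ n ih =>
      intro t ht
      have h1 := W_one_le hk0 t
      have h2 : ∫ s in Iic t, k s * f s ≤ ∫ s in Iic t, (2 * a + B * (1/2)^n) * (k s * W k s) := by
        refine integral_mono_of_nonneg (Eventually.of_forall fun s => mul_nonneg (hk0 s) (hf0 s))
          ((kW_int hk hk0).integrableOn.const_mul _) ?_
        refine (ae_restrict_iff' measurableSet_Iic).2 (Eventually.of_forall fun s hs => ?_)
        have := mul_le_mul_of_nonneg_left (ih s (le_trans hs ht)) (hk0 s)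
        simp only
        linarith
      rw [integral_const_mul] at h2
      have h3 := weight_ineq hk hk0 t
      have h5 : 0 ≤ 2 * a + B * (1/2)^n := by positivity
      have h4 := mul_le_mul_of_nonneg_left h3 h5
      have h6 := h t ht
      rw [pow_succ]
      nlinarith
  have hlim : Tendsto (fun n : ℕ => (2 * a + B * (1/2 : ℝ)^n) * W k t0) atTop
      (𝓝 ((2 * a + B * 0) * W k t0)) := by
    refine Tendsto.mul_const _ (Tendsto.const_add _ (Tendsto.const_mul _ ?_))
    exact tendsto_pow_atTop_nhds_zero_of_lt_one (by norm_num) (by norm_num)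
  have h1 := ge_of_tendsto' hlim fun n => key n t0 le_rfl
  have h2 := mul_le_mul_of_nonneg_left (W_le hk hk0 t0) ha
  unfold GC
  nlinarith

/-- Linear Gronwall for integral curves. -/
lemma lin_gronwall {Y : Type*} [NormedAddCommGroup Y] [NormedSpace ℝ Y]
    {k e : ℝ → ℝ} (hk : Integrable k) (hk0 : ∀ s, 0 ≤ k s)
    {z h : ℝ → Y} {z0 : Y} {t0 B : ℝ} (hz : Continuous z) (hzB : ∀ t, ‖z t‖ ≤ B)
    (he : IntegrableOn e (Iic t0)) (he0 : ∀ s ≤ t0, 0 ≤ e s)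
    (hzi : ∀ t ≤ t0, z t = z0 + ∫ s in Iic t, h s)
    (hb : ∀ᵐ s, s ≤ t0 → ‖h s‖ ≤ k s * ‖z s‖ + e s) :
    ‖z t0‖ ≤ GC k * (‖z0‖ + ∫ s in Iic t0, e s) := by
  have he1 : 0 ≤ ∫ s in Iic t0, e s := setIntegral_nonneg measurableSet_Iic he0
  refine gronwall (f := fun t => ‖z t‖) (B := B) hk hk0 (add_nonneg (norm_nonneg _) he1)
    (fun t => norm_nonneg _) hzB ?_
  intro t ht
  have hkz : Integrable fun s => k s * ‖z s‖ :=
    hk.mul_bdd (c := B) hz.norm.aestronglyMeasurable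
      (Eventually.of_forall fun s => by simpa using hzB s)
  have he' : IntegrableOn e (Iic t) := he.mono_set (Iic_subset_Iic.2 ht)
  have h1 : ‖∫ s in Iic t, h s‖ ≤ ∫ s in Iic t, (k s * ‖z s‖ + e s) := by
    refine norm_integral_le_of_norm_le (hkz.integrableOn.add he') ?_
    refine (ae_restrict_iff' measurableSet_Iic).2 (hb.mono fun s hs hs' => ?_)
    exact hs (le_trans hs' ht)
  rw [integral_add hkz.integrableOn he'] at h1
  have h2 : ∫ s in Iic t, e s ≤ ∫ s in Iic t0, e s :=
    setIntegral_mono_set he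
      ((ae_restrict_iff' measurableSet_Iic).2 (Eventually.of_forall he0))
      (Iic_subset_Iic.2 ht).eventuallyLE
  change ‖z t‖ ≤ _
  rw [hzi t ht]
  refine (norm_add_le _ _).trans ?_
  linarith

/-- Carathéodory existence theorem with Lipschitz right-hand side. -/
lemma carath {Y : Type*} [NormedAddCommGroup Y] [NormedSpace ℝ Y] [CompleteSpace Y]
    {k k' : ℝ → ℝ} (hk : Integrable k) (hk0 : ∀ s, 0 ≤ k s) (hk' : Integrable k')
    (F : ℝ → Y → Y) (hL : ∀ s y y', ‖F s y - F s y'‖ ≤ k s * ‖y - y'‖)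
    (hF0 : ∀ s, ‖F s 0‖ ≤ k' s)
    (hm : ∀ y : ℝ → Y, Continuous y → AEStronglyMeasurable (fun s => F s (y s)) volume)
    (y0 : Y) :
    ∃ y : ℝ → Y, Continuous y ∧ (∃ B, ∀ t, ‖y t‖ ≤ B) ∧ Integrable (fun s => F s (y s)) ∧
      ∀ t, y t = y0 + ∫ s in Iic t, F s (y s) := by
  have hint : ∀ y : ℝ → Y, Continuous y → (∃ B, ∀ t, ‖y t‖ ≤ B) →
      Integrable (fun s => F s (y s)) := by
    rintro y hy ⟨B, hB⟩
    refine ((hk.mul_const B).add hk').mono' (hm y hy) (Eventually.of_forall fun s => ?_)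
    have h1 := hL s (y s) 0
    have h2 := norm_sub_norm_le (F s (y s)) (F s 0)
    have h3 := mul_le_mul_of_nonneg_left (hB s) (hk0 s)
    have h4 := hF0 s
    rw [sub_zero] at h1
    simp only [Pi.add_apply]
    linarith
  let M := Real.exp (2 * ∫ s, k s)
  have hWw : ∀ w : BoundedContinuousFunction ℝ Y,
      Continuous (fun s => W k s • w s) ∧ (∃ B, ∀ t, ‖W k t • w t‖ ≤ B) := by
    intro w
    refine ⟨(W_cont hk).smul w.continuous, M * ‖w‖, fun t => ?_⟩
    rw [norm_smul, Real.norm_of_nonneg (W_pos k t).le]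
    exact mul_le_mul (W_le hk hk0 t) (w.norm_coe_le_norm t) (norm_nonneg _) (Real.exp_pos _).le
  have hintw := fun w : BoundedContinuousFunction ℝ Y => hint _ (hWw w).1 (hWw w).2
  let N : BoundedContinuousFunction ℝ Y → BoundedContinuousFunction ℝ Y := fun w =>
    BoundedContinuousFunction.ofNormedAddCommGroup
      (fun t => (W k t)⁻¹ • (y0 + ∫ s in Iic t, F s (W k s • w s)))
      (((W_cont hk).inv₀ fun t => (W_pos k t).ne').smul
        (continuous_const.add (cont_prim (hintw w))))
      (‖y0‖ + ∫ s, ‖F s (W k s • w s)‖) (by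
        intro t
        rw [norm_smul, norm_inv, Real.norm_of_nonneg (W_pos k t).le]
        have h1 : (W k t)⁻¹ ≤ 1 := inv_le_one_of_one_le₀ (W_one_le hk0 t)
        have h2 : ‖y0 + ∫ s in Iic t, F s (W k s • w s)‖
            ≤ ‖y0‖ + ∫ s, ‖F s (W k s • w s)‖ := by
          refine (norm_add_le _ _).trans (add_le_add le_rfl ?_)
          refine (norm_integral_le_integral_norm _).trans ?_
          exact setIntegral_le_integral (hintw w).norm (Eventually.of_forall fun s => norm_nonneg _)
        calc _ ≤ 1 * ‖y0 + ∫ s in Iic t, F s (W k s • w s)‖ :=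
              mul_le_mul_of_nonneg_right h1 (norm_nonneg _)
          _ ≤ _ := by rw [one_mul]; exact h2)
  have hN : ContractingWith (1/2) N := by
    refine ⟨by rw [← NNReal.coe_lt_coe]; norm_num, LipschitzWith.of_dist_le_mul fun w w' => ?_⟩
    rw [BoundedContinuousFunction.dist_le (by positivity)]
    intro t
    change dist ((W k t)⁻¹ • (y0 + ∫ s in Iic t, F s (W k s • w s)))
      ((W k t)⁻¹ • (y0 + ∫ s in Iic t, F s (W k s • w' s))) ≤ _
    rw [dist_eq_norm, ← smul_sub, add_sub_add_left_eq_sub,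
      ← integral_sub (hintw w).integrableOn (hintw w').integrableOn, norm_smul, norm_inv,
      Real.norm_of_nonneg (W_pos k t).le]
    have h1 : ‖∫ s in Iic t, (F s (W k s • w s) - F s (W k s • w' s))‖
        ≤ ∫ s in Iic t, (k s * W k s) * dist w w' := by
      refine norm_integral_le_of_norm_le ((kW_int hk hk0).mul_const _).integrableOn
        (Eventually.of_forall fun s => ?_)
      refine (hL s _ _).trans ?_
      rw [← smul_sub, norm_smul, Real.norm_of_nonneg (W_pos k s).le, ← mul_assoc]
      refine mul_le_mul_of_nonneg_left ?_ (mul_nonneg (hk0 s) (W_pos k s).le)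
      rw [← dist_eq_norm]
      exact BoundedContinuousFunction.dist_coe_le_dist s
    rw [integral_mul_const] at h1
    have h2 := mul_le_mul_of_nonneg_right (weight_ineq hk hk0 t) (dist_nonneg (x := w) (y := w'))
    have h3 := W_pos k t
    rw [inv_mul_le_iff₀ h3]
    push_cast
    linarith
  obtain ⟨w, hw⟩ : ∃ w, N w = w := ⟨_, hN.fixedPoint_isFixedPt⟩
  refine ⟨fun s => W k s • w s, (hWw w).1, (hWw w).2, hintw w, fun t => ?_⟩
  have h1 : (W k t)⁻¹ • (y0 + ∫ s in Iic t, F s (W k s • w s)) = w t :=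
    congrArg (fun w : BoundedContinuousFunction ℝ Y => w t) hw
  change W k t • w t = _
  rw [← h1, smul_inv_smul₀ (W_pos k t).ne']

end FY
end

section
set_option maxSynthPendingDepth 3
set_option linter.unusedSectionVars false
namespace FY

/-- integral curves -/
structure IsCrv {Y : Type*} [NormedAddCommGroup Y] [NormedSpace ℝ Y]
    (F : ℝ → Y → Y) (y0 : Y) (y : ℝ → Y) : Prop where
  cont : Continuous y
  bdd : ∃ B, ∀ t, ‖y t‖ ≤ B
  int : Integrable (fun s => F s (y s))
  eq : ∀ t, y t = y0 + ∫ s in Iic t, F s (y s)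

lemma IsCrv.sub_le {Y : Type*} [NormedAddCommGroup Y] [NormedSpace ℝ Y]
    {F : ℝ → Y → Y} {y0 : Y} {y : ℝ → Y} (h : IsCrv F y0 y) {b : ℝ → ℝ} (hb : Integrable b)
    (hF : ∀ s, ‖F s (y s)‖ ≤ b s) {t' t : ℝ} (htt : t' ≤ t) :
    ‖y t - y t'‖ ≤ ∫ s in Ioc t' t, b s := by
  rw [h.eq t, h.eq t', add_sub_add_left_eq_sub,
    intervalIntegral.integral_Iic_sub_Iic h.int.integrableOn h.int.integrableOn,
    intervalIntegral.integral_of_le htt]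
  exact norm_integral_le_of_norm_le hb.integrableOn (Eventually.of_forall hF)

lemma IsCrv.sub0_le {Y : Type*} [NormedAddCommGroup Y] [NormedSpace ℝ Y]
    {F : ℝ → Y → Y} {y0 : Y} {y : ℝ → Y} (h : IsCrv F y0 y) {b : ℝ → ℝ} (hb : Integrable b)
    (hF : ∀ s, ‖F s (y s)‖ ≤ b s) (t : ℝ) :
    ‖y t - y0‖ ≤ ∫ s in Iic t, b s := by
  rw [h.eq t, add_sub_cancel_left]
  exact norm_integral_le_of_norm_le hb.integrableOn (Eventually.of_forall hF)

variable {E : Type*} [NormedAddCommGroup E] [NormedSpace ℝ E]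

/-- first derivative -/
abbrev D1 (f : ℝ → E → E) (s : ℝ) (x : E) : E →L[ℝ] E := fderiv ℝ (f s) x
/-- second derivative -/
abbrev D2 (f : ℝ → E → E) (s : ℝ) (x : E) : E →L[ℝ] E →L[ℝ] E := fderiv ℝ (fderiv ℝ (f s)) x

/-- time dependent vector fields -/
structure VF (f : ℝ → E → E) (k : ℝ → ℝ) : Prop where
  int : Integrable k
  smooth : ∀ s, ContDiff ℝ 2 (f s)
  b0 : ∀ s x, ‖f s x‖ ≤ k s
  b1 : ∀ s x, ‖D1 f s x‖ ≤ k s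
  b2 : ∀ s x, ‖D2 f s x‖ ≤ k s
  d0 : ∀ s, Tendsto (fun x => f s x) (cocompact E) (𝓝 0)
  d1 : ∀ s, Tendsto (fun x => D1 f s x) (cocompact E) (𝓝 0)
  d2 : ∀ s, Tendsto (fun x => D2 f s x) (cocompact E) (𝓝 0)
  m0 : ∀ y : ℝ → E, Continuous y → AEStronglyMeasurable (fun s => f s (y s)) volume
  m1 : ∀ y : ℝ → E, Continuous y → AEStronglyMeasurable (fun s => D1 f s (y s)) volume
  m2 : ∀ y : ℝ → E, Continuous y → AEStronglyMeasurable (fun s => D2 f s (y s)) volume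

/-- quadratic part of the second variation -/
def S (b : E →L[ℝ] E →L[ℝ] E) (p : E →L[ℝ] E) : E →L[ℝ] E →L[ℝ] E :=
  ((ContinuousLinearMap.compL ℝ E E E).flip p).comp (b.comp p)

/-- linear part of the second variation -/
def Lq (d : E →L[ℝ] E) (q : E →L[ℝ] E →L[ℝ] E) : E →L[ℝ] E →L[ℝ] E :=
  (ContinuousLinearMap.compL ℝ E E E d).comp q

lemma S_apply (b : E →L[ℝ] E →L[ℝ] E) (p : E →L[ℝ] E) (h : E) :
    S b p h = (b (p h)).comp p := rfl

lemma Lq_apply (d : E →L[ℝ] E) (q : E →L[ℝ] E →L[ℝ] E) (h : E) :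
    Lq d q h = d.comp (q h) := rfl

lemma S_norm (b : E →L[ℝ] E →L[ℝ] E) (p : E →L[ℝ] E) : ‖S b p‖ ≤ ‖b‖ * (‖p‖ * ‖p‖) := by
  refine ContinuousLinearMap.opNorm_le_bound _ (by positivity) fun h => ?_
  rw [S_apply]
  refine (ContinuousLinearMap.opNorm_comp_le _ _).trans ?_
  have h1 := b.le_opNorm (p h)
  have h2 := p.le_opNorm h
  have h3 : ‖b (p h)‖ ≤ ‖b‖ * (‖p‖ * ‖h‖) :=
    h1.trans (mul_le_mul_of_nonneg_left h2 (norm_nonneg _))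
  calc _ ≤ ‖b‖ * (‖p‖ * ‖h‖) * ‖p‖ := mul_le_mul_of_nonneg_right h3 (norm_nonneg _)
    _ = _ := by ring

lemma Lq_norm (d : E →L[ℝ] E) (q : E →L[ℝ] E →L[ℝ] E) : ‖Lq d q‖ ≤ ‖d‖ * ‖q‖ := by
  refine ContinuousLinearMap.opNorm_le_bound _ (by positivity) fun h => ?_
  rw [Lq_apply]
  refine (ContinuousLinearMap.opNorm_comp_le _ _).trans ?_
  rw [mul_assoc]
  exact mul_le_mul_of_nonneg_left (q.le_opNorm h) (norm_nonneg _)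

lemma Lq_sub_right (d : E →L[ℝ] E) (q q' : E →L[ℝ] E →L[ℝ] E) :
    Lq d q - Lq d q' = Lq d (q - q') := by
  ext h h'; simp [Lq_apply]

lemma Lq_sub_left (d d' : E →L[ℝ] E) (q : E →L[ℝ] E →L[ℝ] E) :
    Lq d q - Lq d' q = Lq (d - d') q := by
  ext h h'; simp [Lq_apply]

lemma S_cont : Continuous fun z : (E →L[ℝ] E →L[ℝ] E) × (E →L[ℝ] E) => S z.1 z.2 := by
  unfold S
  exact (((ContinuousLinearMap.compL ℝ E E E).flip.continuous.comp continuous_snd).clm_comp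
    (continuous_fst.clm_comp continuous_snd))

lemma Lq_cont : Continuous fun z : (E →L[ℝ] E) × (E →L[ℝ] E →L[ℝ] E) => Lq z.1 z.2 := by
  unfold Lq
  exact (((ContinuousLinearMap.compL ℝ E E E).continuous.comp continuous_fst).clm_comp
    continuous_snd)

namespace VF
variable {f : ℝ → E → E} {k : ℝ → ℝ}

lemma k0 (h : VF f k) (s : ℝ) : 0 ≤ k s := (norm_nonneg _).trans (h.b0 s 0)

lemma diff0 (h : VF f k) (s : ℝ) : Differentiable ℝ (f s) :=
  (h.smooth s).differentiable (by norm_num)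

lemma cd1 (h : VF f k) (s : ℝ) : ContDiff ℝ 1 (fun x => D1 f s x) :=
  (h.smooth s).fderiv_right (by norm_num)

lemma diff1 (h : VF f k) (s : ℝ) : Differentiable ℝ (fun x => D1 f s x) :=
  (h.cd1 s).differentiable (by norm_num)

lemma cont2 (h : VF f k) (s : ℝ) : Continuous (fun x => D2 f s x) :=
  (h.cd1 s).continuous_fderiv (by norm_num)

lemma lip0 (h : VF f k) (s : ℝ) (x y : E) : ‖f s x - f s y‖ ≤ k s * ‖x - y‖ :=
  convex_univ.norm_image_sub_le_of_norm_fderiv_le (fun z _ => h.diff0 s z)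
    (fun z _ => h.b1 s z) (mem_univ y) (mem_univ x)

lemma lip1 (h : VF f k) (s : ℝ) (x y : E) : ‖D1 f s x - D1 f s y‖ ≤ k s * ‖x - y‖ :=
  convex_univ.norm_image_sub_le_of_norm_fderiv_le (fun z _ => h.diff1 s z)
    (fun z _ => h.b2 s z) (mem_univ y) (mem_univ x)

lemma quad (h : VF f k) (s : ℝ) (x y : E) :
    ‖f s y - f s x - D1 f s x (y - x)‖ ≤ k s * ‖y - x‖ * ‖y - x‖ := by
  refine (convex_closedBall x ‖y - x‖).norm_image_sub_le_of_norm_fderiv_le' (𝕜 := ℝ)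
    (fun z _ => h.diff0 s z) (fun z hz => ?_) (by simp)
    (by simp [dist_eq_norm])
  refine (h.lip1 s z x).trans (mul_le_mul_of_nonneg_left ?_ (h.k0 s))
  rwa [mem_closedBall_iff_norm] at hz

end VF

/-- flow with first two derivatives -/
structure FD (f : ℝ → E → E) (φ : ℝ → E → E) (P : ℝ → E → E →L[ℝ] E)
    (Q : ℝ → E → E →L[ℝ] E →L[ℝ] E) : Prop where
  c0 : ∀ x, IsCrv f x fun t => φ t x
  c1 : ∀ x, IsCrv (fun s p => (D1 f s (φ s x)).comp p) (ContinuousLinearMap.id ℝ E)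
    fun t => P t x
  c2 : ∀ x, IsCrv (fun s q => S (D2 f s (φ s x)) (P s x) + Lq (D1 f s (φ s x)) q) 0
    fun t => Q t x

lemma exists_crv {Y : Type*} [NormedAddCommGroup Y] [NormedSpace ℝ Y] [CompleteSpace Y]
    {k k' : ℝ → ℝ} (hk : Integrable k) (hk0 : ∀ s, 0 ≤ k s) (hk' : Integrable k')
    (F : ℝ → Y → Y) (hL : ∀ s y y', ‖F s y - F s y'‖ ≤ k s * ‖y - y'‖)
    (hF0 : ∀ s, ‖F s 0‖ ≤ k' s)
    (hm : ∀ y : ℝ → Y, Continuous y → AEStronglyMeasurable (fun s => F s (y s)) volume)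
    (y0 : Y) : ∃ y, IsCrv F y0 y := by
  obtain ⟨y, h1, h2, h3, h4⟩ := carath hk hk0 hk' F hL hF0 hm y0
  exact ⟨y, h1, h2, h3, h4⟩

lemma exists_flow [CompleteSpace E] {f : ℝ → E → E} {k : ℝ → ℝ} (h : VF f k) :
    ∃ φ P Q, FD f φ P Q := by
  have h0 : ∀ x, ∃ y, IsCrv f x y := fun x =>
    exists_crv h.int h.k0 h.int f h.lip0 (fun s => h.b0 s 0) h.m0 x
  choose φ hφ using h0
  have h1 : ∀ x, ∃ p, IsCrv (fun s p => (D1 f s (φ x s)).comp p) (ContinuousLinearMap.id ℝ E) p := by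
    intro x
    refine exists_crv (k' := fun _ => 0) h.int h.k0 (by simp) _ (fun s y y' => ?_) (fun s => by simp)
      (fun y hy => ?_) _
    · rw [← ContinuousLinearMap.comp_sub]
      exact (ContinuousLinearMap.opNorm_comp_le _ _).trans
        (mul_le_mul_of_nonneg_right (h.b1 s _) (norm_nonneg _))
    · have hc : Continuous fun z : (E →L[ℝ] E) × (E →L[ℝ] E) => z.1.comp z.2 :=
        continuous_fst.clm_comp continuous_snd
      exact hc.comp_aestronglyMeasurable
        ((h.m1 _ (hφ x).cont).prodMk hy.aestronglyMeasurable)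
  choose P hP using h1
  have h2 : ∀ x, ∃ q, IsCrv (fun s q => S (D2 f s (φ x s)) (P x s) + Lq (D1 f s (φ x s)) q) 0 q := by
    intro x
    obtain ⟨B, hB⟩ := (hP x).bdd
    have hB0 : 0 ≤ B := (norm_nonneg _).trans (hB 0)
    refine exists_crv (k' := fun s => k s * (B * B)) h.int h.k0 (h.int.mul_const _) _
      (fun s y y' => ?_) (fun s => ?_) (fun y hy => ?_) _
    · rw [add_sub_add_left_eq_sub, Lq_sub_right]
      exact (Lq_norm _ _).trans (mul_le_mul_of_nonneg_right (h.b1 s _) (by positivity))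
    · have : Lq (D1 f s (φ x s)) 0 = 0 := by ext; simp [Lq_apply]
      rw [this, add_zero]
      refine (S_norm _ _).trans ?_
      exact mul_le_mul (h.b2 s _) (mul_le_mul (hB s) (hB s) (norm_nonneg _) hB0)
        (by positivity) (h.k0 s)
    · exact (S_cont.comp_aestronglyMeasurable
        ((h.m2 _ (hφ x).cont).prodMk (hP x).cont.aestronglyMeasurable)).add
        (Lq_cont.comp_aestronglyMeasurable
        ((h.m1 _ (hφ x).cont).prodMk hy.aestronglyMeasurable))
  choose Q hQ using h2
  exact ⟨fun t x => φ x t, fun t x => P x t, fun t x => Q x t, hφ, hP, hQ⟩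

/-- comparison of curves -/
lemma cmp0 {f f' : ℝ → E → E} {k d : ℝ → ℝ} (h : VF f k)
    {y0 y0' : E} {y y' : ℝ → E} (hy : IsCrv f y0 y) (hy' : IsCrv f' y0' y')
    (hd : Integrable d) (hd0 : ∀ s, 0 ≤ d s) {t : ℝ}
    (hff : ∀ᵐ s, s ≤ t → ∀ x, ‖f s x - f' s x‖ ≤ d s) :
    ‖y t - y' t‖ ≤ GC k * (‖y0 - y0'‖ + ∫ s in Iic t, d s) := by
  obtain ⟨B, hB⟩ := hy.bdd
  obtain ⟨B', hB'⟩ := hy'.bdd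
  refine lin_gronwall (z := fun t => y t - y' t) (h := fun s => f s (y s) - f' s (y' s))
    (B := B + B') h.int h.k0 (hy.cont.sub hy'.cont)
    (fun t => (norm_sub_le _ _).trans (add_le_add (hB t) (hB' t))) hd.integrableOn
    (fun s _ => hd0 s) (fun s _ => ?_) (hff.mono fun s hs hst => ?_)
  · rw [integral_sub hy.int.integrableOn hy'.int.integrableOn, hy.eq s, hy'.eq s]
    abel
  · have : f s (y s) - f' s (y' s) = (f s (y s) - f s (y' s)) + (f s (y' s) - f' s (y' s)) := by abel
    rw [this]
    exact (norm_add_le _ _).trans (add_le_add (h.lip0 s _ _) (hs hst _))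

lemma crv1_bound {f : ℝ → E → E} {k : ℝ → ℝ} (h : VF f k) {y : ℝ → E}
    {p : ℝ → E →L[ℝ] E}
    (hp : IsCrv (fun s p => (D1 f s (y s)).comp p) (ContinuousLinearMap.id ℝ E) p) (t : ℝ) :
    ‖p t‖ ≤ GC k := by
  obtain ⟨B, hB⟩ := hp.bdd
  have := lin_gronwall (e := fun _ => 0) (t0 := t) h.int h.k0 hp.cont hB (by simp) (by simp)
    (fun t _ => hp.eq t) (Eventually.of_forall fun s _ => by
      rw [add_zero]
      exact (ContinuousLinearMap.opNorm_comp_le _ _).trans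
        (mul_le_mul_of_nonneg_right (h.b1 s _) (norm_nonneg _)))
  simp only [integral_zero, add_zero] at this
  calc _ ≤ _ := this
    _ ≤ GC k * 1 := mul_le_mul_of_nonneg_left ContinuousLinearMap.norm_id_le (GC_nonneg k)
    _ = _ := mul_one _

lemma cmp1 {f f' : ℝ → E → E} {k d : ℝ → ℝ} (h : VF f k) (h' : VF f' k)
    {y y' : ℝ → E} {p p' : ℝ → E →L[ℝ] E}
    (hp : IsCrv (fun s p => (D1 f s (y s)).comp p) (ContinuousLinearMap.id ℝ E) p)
    (hp' : IsCrv (fun s p => (D1 f' s (y' s)).comp p) (ContinuousLinearMap.id ℝ E) p')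
    (hd : Integrable d) (hd0 : ∀ s, 0 ≤ d s) {t δ : ℝ} (hδ : ∀ s ≤ t, ‖y s - y' s‖ ≤ δ)
    (hff : ∀ᵐ s, s ≤ t → ∀ x, ‖D1 f s x - D1 f' s x‖ ≤ d s) :
    ‖p t - p' t‖ ≤ GC k * (GC k * (δ * (∫ s, k s) + ∫ s in Iic t, d s)) := by
  obtain ⟨B, hB⟩ := hp.bdd
  obtain ⟨B', hB'⟩ := hp'.bdd
  have hδ0 : 0 ≤ δ := (norm_nonneg _).trans (hδ t le_rfl)
  have hG := GC_nonneg k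
  have h1 := lin_gronwall (z := fun t => p t - p' t) (z0 := 0) (t0 := t)
    (h := fun s => (D1 f s (y s)).comp (p s) - (D1 f' s (y' s)).comp (p' s))
    (B := B + B') (e := fun s => GC k * (δ * k s + d s)) h.int h.k0 (hp.cont.sub hp'.cont)
    (fun t => (norm_sub_le _ _).trans (add_le_add (hB t) (hB' t)))
    (((h.int.const_mul δ).add hd).const_mul _).integrableOn
    (fun s _ => mul_nonneg hG (add_nonneg (mul_nonneg hδ0 (h.k0 s)) (hd0 s)))
    (fun s _ => ?_) (hff.mono fun s hs hst => ?_)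
  · refine h1.trans (mul_le_mul_of_nonneg_left ?_ hG)
    rw [norm_zero, zero_add, integral_const_mul,
      integral_add (h.int.const_mul δ).integrableOn hd.integrableOn, integral_const_mul]
    refine mul_le_mul_of_nonneg_left ?_ hG
    exact add_le_add (mul_le_mul_of_nonneg_left (prim_le h.int h.k0 t) hδ0) le_rfl
  · rw [integral_sub hp.int.integrableOn hp'.int.integrableOn, hp.eq s, hp'.eq s]
    abel
  · have e1 : (D1 f s (y s)).comp (p s) - (D1 f' s (y' s)).comp (p' s)
        = (D1 f s (y s)).comp (p s - p' s) + ((D1 f s (y s) - D1 f s (y' s))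
          + (D1 f s (y' s) - D1 f' s (y' s))).comp (p' s) := by
      ext v; simp
    rw [e1]
    refine (norm_add_le _ _).trans (add_le_add ?_ ?_)
    · exact (ContinuousLinearMap.opNorm_comp_le _ _).trans
        (mul_le_mul_of_nonneg_right (h.b1 s _) (norm_nonneg _))
    · refine (ContinuousLinearMap.opNorm_comp_le _ _).trans ?_
      rw [mul_comm]
      refine mul_le_mul (crv1_bound h' hp' s) ?_ (norm_nonneg _) hG
      refine (norm_add_le _ _).trans (add_le_add ?_ (hs hst _))
      rw [mul_comm]
      exact (h.lip1 s _ _).trans (mul_le_mul_of_nonneg_left (hδ s hst) (h.k0 s))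

end FY
end

section
set_option maxSynthPendingDepth 3
set_option linter.unusedSectionVars false
namespace FY
variable {E : Type*} [NormedAddCommGroup E] [NormedSpace ℝ E] [CompleteSpace E]

namespace FD
variable {f : ℝ → E → E} {k : ℝ → ℝ} {φ : ℝ → E → E} {P : ℝ → E → E →L[ℝ] E}
    {Q : ℝ → E → E →L[ℝ] E →L[ℝ] E}

lemma bP (H : FD f φ P Q) (h : VF f k) (t : ℝ) (x : E) : ‖P t x‖ ≤ GC k := crv1_bound h (H.c1 x) t

/-- bound of second derivative -/
def QB (k : ℝ → ℝ) : ℝ := GC k * ((∫ s, k s) * (GC k * GC k))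

lemma bS (H : FD f φ P Q) (h : VF f k) (s : ℝ) (x : E) :
    ‖S (D2 f s (φ s x)) (P s x)‖ ≤ k s * (GC k * GC k) :=
  (S_norm _ _).trans (mul_le_mul (h.b2 s _) (mul_le_mul (H.bP h s x) (H.bP h s x)
    (norm_nonneg _) (GC_nonneg k)) (by positivity) (h.k0 s))

lemma bQ (H : FD f φ P Q) (h : VF f k) (t : ℝ) (x : E) : ‖Q t x‖ ≤ QB k := by
  obtain ⟨B, hB⟩ := (H.c2 x).bdd
  have hG := GC_nonneg k
  have := lin_gronwall (e := fun s => k s * (GC k * GC k)) (t0 := t) h.int h.k0 (H.c2 x).cont hB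
    (h.int.mul_const _).integrableOn (fun s _ => mul_nonneg (h.k0 s) (by positivity))
    (fun t _ => (H.c2 x).eq t) (Eventually.of_forall fun s _ => by
      rw [add_comm (k s * _)]
      refine (norm_add_le _ _).trans (add_le_add (H.bS h s x) ((Lq_norm _ _).trans
        (mul_le_mul_of_nonneg_right (h.b1 s _) (by positivity)))))
  refine this.trans (mul_le_mul_of_nonneg_left ?_ hG)
  rw [norm_zero, zero_add, integral_mul_const]
  exact mul_le_mul_of_nonneg_right (prim_le h.int h.k0 t) (by positivity)

lemma QB_nonneg (h : VF f k) : 0 ≤ QB k := by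
  have := GC_nonneg k
  have : 0 ≤ ∫ s, k s := integral_nonneg h.k0
  unfold QB; positivity

lemma lipφ (H : FD f φ P Q) (h : VF f k) (t : ℝ) (x y : E) :
    ‖φ t x - φ t y‖ ≤ GC k * ‖x - y‖ := by
  have := cmp0 (d := fun _ => 0) (t := t) h (H.c0 x) (H.c0 y) (by simp) (by simp)
    (Eventually.of_forall fun s _ x => by simp)
  simpa using this

lemma lipP (H : FD f φ P Q) (h : VF f k) (t : ℝ) (x y : E) :
    ‖P t x - P t y‖ ≤ QB k * ‖x - y‖ := by
  have := cmp1 (d := fun _ => 0) (t := t) (δ := GC k * ‖x - y‖) h h (H.c1 x) (H.c1 y) (by simp)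
    (by simp) (fun s _ => H.lipφ h s x y) (Eventually.of_forall fun s _ x => by simp)
  simp only [integral_zero, add_zero] at this
  refine this.trans (le_of_eq ?_)
  unfold QB; ring

lemma derivφ (H : FD f φ P Q) (h : VF f k) (t : ℝ) (x : E) :
    HasFDerivAt (φ t) (P t x) x := by
  rw [hasFDerivAt_iff_tendsto]
  have hG := GC_nonneg k
  have key : ∀ y, ‖φ t y - φ t x - P t x (y - x)‖
      ≤ GC k * ((∫ s, k s) * ((GC k * ‖y - x‖) * (GC k * ‖y - x‖))) := by
    intro y
    obtain ⟨B1, hB1⟩ := (H.c0 y).bdd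
    obtain ⟨B2, hB2⟩ := (H.c0 x).bdd
    have hPi := (ContinuousLinearMap.apply ℝ E (y - x)).integrable_comp (H.c1 x).int
    have := lin_gronwall (e := fun s => k s * ((GC k * ‖y - x‖) * (GC k * ‖y - x‖))) (t0 := t)
      (z := fun t => φ t y - φ t x - P t x (y - x)) (z0 := 0)
      (h := fun s => f s (φ s y) - f s (φ s x) - D1 f s (φ s x) (P s x (y - x)))
      (B := B1 + B2 + GC k * ‖y - x‖)
      h.int h.k0 (((H.c0 y).cont.sub (H.c0 x).cont).sub ((H.c1 x).cont.clm_apply continuous_const))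
      (fun t => (norm_sub_le _ _).trans (add_le_add ((norm_sub_le _ _).trans
        (add_le_add (hB1 t) (hB2 t))) ((P t x).le_of_opNorm_le (H.bP h t x) _)))
      (h.int.mul_const _).integrableOn (fun s _ => mul_nonneg (h.k0 s) (by positivity))
      (fun s _ => ?_) (Eventually.of_forall fun s _ => ?_)
    · refine this.trans (mul_le_mul_of_nonneg_left ?_ hG)
      rw [norm_zero, zero_add, integral_mul_const]
      exact mul_le_mul_of_nonneg_right (prim_le h.int h.k0 t) (by positivity)
    · have e1 : (∫ s in Iic s, D1 f s (φ s x) (P s x (y - x)))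
          = (∫ s in Iic s, (D1 f s (φ s x)).comp (P s x)) (y - x) :=
        (ContinuousLinearMap.apply ℝ E (y - x)).integral_comp_comm
          (H.c1 x).int.integrableOn
      have e2 := integral_sub (μ := volume.restrict (Iic s)) ((H.c0 y).int.sub (H.c0 x).int).integrableOn
        hPi.integrableOn
      change (∫ s in Iic s, (f s (φ s y) - f s (φ s x) - D1 f s (φ s x) (P s x (y - x)))) =
        (∫ s in Iic s, (f s (φ s y) - f s (φ s x))) -
          ∫ s in Iic s, D1 f s (φ s x) (P s x (y - x)) at e2
      rw [e2, integral_sub (H.c0 y).int.integrableOn (H.c0 x).int.integrableOn, e1, (H.c0 y).eq s,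
        (H.c0 x).eq s, (H.c1 x).eq s]
      simp only [add_apply, ContinuousLinearMap.id_apply]
      abel
    · have e1 : f s (φ s y) - f s (φ s x) - D1 f s (φ s x) (P s x (y - x))
          = D1 f s (φ s x) (φ s y - φ s x - P s x (y - x))
            + (f s (φ s y) - f s (φ s x) - D1 f s (φ s x) (φ s y - φ s x)) := by
        rw [map_sub (D1 f s (φ s x)) (φ s y - φ s x)]; abel
      rw [e1]
      refine (norm_add_le _ _).trans (add_le_add
        ((D1 f s (φ s x)).le_of_opNorm_le (h.b1 s _) _) ((h.quad s _ _).trans ?_))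
      rw [mul_assoc]
      have := H.lipφ h s y x
      exact mul_le_mul_of_nonneg_left (mul_le_mul this this (norm_nonneg _) (by positivity)) (h.k0 s)
  have hlim : Tendsto (fun y => GC k * ((∫ s, k s) * (GC k * GC k)) * ‖y - x‖) (𝓝 x) (𝓝 0) := by
    have : Continuous fun y => GC k * ((∫ s, k s) * (GC k * GC k)) * ‖y - x‖ := by fun_prop
    simpa using this.tendsto x
  refine squeeze_zero (fun y => by positivity) (fun y => ?_) hlim
  by_cases hxy : ‖y - x‖ = 0
  · simp [hxy]
  · have := mul_le_mul_of_nonneg_left (key y) (inv_nonneg.2 (norm_nonneg (y - x)))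
    refine this.trans (le_of_eq ?_)
    field_simp

lemma contφ (H : FD f φ P Q) (h : VF f k) (t : ℝ) : Continuous (φ t) :=
  continuous_iff_continuousAt.2 fun x => (H.derivφ h t x).continuousAt

lemma contP (H : FD f φ P Q) (h : VF f k) (t : ℝ) : Continuous (P t) := by
  have : LipschitzWith (Real.toNNReal (QB k)) (P t) := LipschitzWith.of_dist_le_mul fun x y => by
    rw [dist_eq_norm, dist_eq_norm, Real.coe_toNNReal _ (QB_nonneg h)]
    exact H.lipP h t x y
  exact this.continuous

lemma derivP (H : FD f φ P Q) (h : VF f k) (t : ℝ) (x : E) :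
    HasFDerivAt (P t) (Q t x) x := by
  rw [hasFDerivAt_iff_tendsto]
  have hG := GC_nonneg k
  have hQB := QB_nonneg h
  -- the error density
  let e : E → ℝ → ℝ := fun y s =>
    ‖D1 f s (φ s y) - D1 f s (φ s x) - D2 f s (φ s x) (P s x (y - x))‖
  have he_meas : ∀ y, AEStronglyMeasurable (e y) volume := by
    intro y
    have hc : Continuous fun z : (E →L[ℝ] E →L[ℝ] E) × E => z.1 z.2 :=
      continuous_fst.clm_apply continuous_snd
    exact (((h.m1 _ (H.c0 y).cont).sub (h.m1 _ (H.c0 x).cont)).sub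
      (hc.comp_aestronglyMeasurable ((h.m2 _ (H.c0 x).cont).prodMk
        ((H.c1 x).cont.clm_apply continuous_const).aestronglyMeasurable))).norm
  have he_le : ∀ y s, e y s ≤ 2 * GC k * k s * ‖y - x‖ := by
    intro y s
    have h1 : ‖D1 f s (φ s y) - D1 f s (φ s x)‖ ≤ k s * (GC k * ‖y - x‖) :=
      (h.lip1 s _ _).trans (mul_le_mul_of_nonneg_left (H.lipφ h s y x) (h.k0 s))
    have h2 : ‖D2 f s (φ s x) (P s x (y - x))‖ ≤ k s * (GC k * ‖y - x‖) :=
      ((D2 f s (φ s x)).le_opNorm _).trans (mul_le_mul (h.b2 s _)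
        ((P s x).le_of_opNorm_le (H.bP h s x) _) (by positivity) (h.k0 s))
    refine (norm_sub_le _ _).trans ((add_le_add h1 h2).trans (le_of_eq ?_))
    ring
  have he_int : ∀ y, Integrable (e y) := fun y =>
    ((h.int.const_mul (2 * GC k)).mul_const ‖y - x‖).mono' (he_meas y)
      (Eventually.of_forall fun s => by rw [Real.norm_of_nonneg (norm_nonneg _)]; exact he_le y s)
  have he_lim : Tendsto (fun y => ∫ s in Iic t, ‖y - x‖⁻¹ * e y s) (𝓝 x) (𝓝 0) := by
    have : (0:ℝ) = ∫ s in Iic t, (0:ℝ) := by simp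
    rw [this]
    refine tendsto_integral_filter_of_dominated_convergence (fun s => 2 * GC k * k s)
      (Eventually.of_forall fun y => ((he_meas y).const_mul _).restrict)
      (Eventually.of_forall fun y => Eventually.of_forall fun s => ?_)
      (h.int.const_mul _).integrableOn (Eventually.of_forall fun s => ?_)
    · have hn : 0 ≤ ‖y - x‖⁻¹ * e y s := mul_nonneg (by positivity) (norm_nonneg _)
      rw [Real.norm_of_nonneg hn]
      by_cases hxy : ‖y - x‖ = 0
      · rw [hxy]; have := h.k0 s; simp only [inv_zero, zero_mul]; positivity
      · rw [inv_mul_le_iff₀ (by positivity), mul_comm]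
        exact he_le y s
    · have hd : HasFDerivAt (fun y => D1 f s (φ s y)) ((D2 f s (φ s x)).comp (P s x)) x :=
        HasFDerivAt.comp x (g := fun x => D1 f s x)
          (h.diff1 s (φ s x)).hasFDerivAt (H.derivφ h s x)
      rw [hasFDerivAt_iff_tendsto] at hd
      exact hd
  have key : ∀ y, ‖P t y - P t x - Q t x (y - x)‖
      ≤ GC k * (GC k * (∫ s in Iic t, e y s)
        + (∫ s, k s) * ((GC k * ‖y - x‖) * (QB k * ‖y - x‖))) := by
    intro y
    have hQi := (ContinuousLinearMap.apply ℝ (E →L[ℝ] E) (y - x)).integrable_comp (H.c2 x).int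
    have hei : Integrable fun s => k s * ((GC k * ‖y - x‖) * (QB k * ‖y - x‖)) :=
      h.int.mul_const _
    have := lin_gronwall (e := fun s => GC k * e y s
        + k s * ((GC k * ‖y - x‖) * (QB k * ‖y - x‖))) (t0 := t)
      (z := fun t => P t y - P t x - Q t x (y - x)) (z0 := 0)
      (h := fun s => (D1 f s (φ s y)).comp (P s y) - (D1 f s (φ s x)).comp (P s x)
        - (S (D2 f s (φ s x)) (P s x) + Lq (D1 f s (φ s x)) (Q s x)) (y - x))
      (B := GC k + GC k + QB k * ‖y - x‖)
      h.int h.k0 (((H.c1 y).cont.sub (H.c1 x).cont).sub ((H.c2 x).cont.clm_apply continuous_const))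
      (fun t => (norm_sub_le _ _).trans (add_le_add ((norm_sub_le _ _).trans
        (add_le_add (H.bP h t y) (H.bP h t x))) ((Q t x).le_of_opNorm_le (H.bQ h t x) _)))
      (((he_int y).const_mul _).add hei).integrableOn
      (fun s _ => add_nonneg (mul_nonneg hG (norm_nonneg _))
        (mul_nonneg (h.k0 s) (by positivity)))
      (fun s _ => ?_) (Eventually.of_forall fun s _ => ?_)
    · refine this.trans (mul_le_mul_of_nonneg_left ?_ hG)
      rw [norm_zero, zero_add, integral_add ((he_int y).const_mul _).integrableOn
        hei.integrableOn, integral_mul_const, integral_const_mul]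
      exact add_le_add le_rfl
        (mul_le_mul_of_nonneg_right (prim_le h.int h.k0 t) (by positivity))
    · have e1 : (∫ s in Iic s, (S (D2 f s (φ s x)) (P s x) + Lq (D1 f s (φ s x)) (Q s x)) (y - x))
          = (∫ s in Iic s, (S (D2 f s (φ s x)) (P s x) + Lq (D1 f s (φ s x)) (Q s x))) (y - x) :=
        (ContinuousLinearMap.apply ℝ (E →L[ℝ] E) (y - x)).integral_comp_comm
          (H.c2 x).int.integrableOn
      have e2 := integral_sub (μ := volume.restrict (Iic s)) ((H.c1 y).int.sub (H.c1 x).int).integrableOn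
        hQi.integrableOn
      change (∫ s in Iic s, ((D1 f s (φ s y)).comp (P s y) - (D1 f s (φ s x)).comp (P s x)
          - (S (D2 f s (φ s x)) (P s x) + Lq (D1 f s (φ s x)) (Q s x)) (y - x))) =
        (∫ s in Iic s, ((D1 f s (φ s y)).comp (P s y) - (D1 f s (φ s x)).comp (P s x))) -
          ∫ s in Iic s, (S (D2 f s (φ s x)) (P s x) + Lq (D1 f s (φ s x)) (Q s x)) (y - x) at e2
      rw [e2, integral_sub (H.c1 y).int.integrableOn (H.c1 x).int.integrableOn, e1, (H.c1 y).eq s,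
        (H.c1 x).eq s, (H.c2 x).eq s]
      simp only [zero_add]
      abel
    · have e1 : (D1 f s (φ s y)).comp (P s y) - (D1 f s (φ s x)).comp (P s x)
        - (S (D2 f s (φ s x)) (P s x) + Lq (D1 f s (φ s x)) (Q s x)) (y - x)
          = (D1 f s (φ s x)).comp (P s y - P s x - Q s x (y - x))
            + ((D1 f s (φ s y) - D1 f s (φ s x) - D2 f s (φ s x) (P s x (y - x))).comp (P s x)
            + (D1 f s (φ s y) - D1 f s (φ s x)).comp (P s y - P s x)) := by
        simp only [add_apply, S_apply, Lq_apply, ContinuousLinearMap.comp_sub,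
          ContinuousLinearMap.sub_comp]
        abel
      rw [e1]
      refine (norm_add_le _ _).trans (add_le_add ?_ ((norm_add_le _ _).trans (add_le_add ?_ ?_)))
      · exact (ContinuousLinearMap.opNorm_comp_le _ _).trans
          (mul_le_mul_of_nonneg_right (h.b1 s _) (norm_nonneg _))
      · refine (ContinuousLinearMap.opNorm_comp_le _ _).trans ?_
        rw [mul_comm]
        exact mul_le_mul_of_nonneg_right (H.bP h s x) (norm_nonneg _)
      · refine (ContinuousLinearMap.opNorm_comp_le _ _).trans ?_
        rw [← mul_assoc]
        refine mul_le_mul ((h.lip1 s _ _).trans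
          (mul_le_mul_of_nonneg_left (H.lipφ h s y x) (h.k0 s))) (H.lipP h s y x)
          (norm_nonneg _) (mul_nonneg (h.k0 s) (by positivity))
  have hlim : Tendsto (fun y => GC k * (GC k * (∫ s in Iic t, ‖y - x‖⁻¹ * e y s)
      + (∫ s, k s) * GC k * QB k * ‖y - x‖)) (𝓝 x) (𝓝 0) := by
    have h1 : Tendsto (fun y => (∫ s, k s) * GC k * QB k * ‖y - x‖) (𝓝 x) (𝓝 0) := by
      have : Continuous fun y => (∫ s, k s) * GC k * QB k * ‖y - x‖ := by fun_prop
      simpa using this.tendsto x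
    simpa using ((he_lim.const_mul (GC k)).add h1).const_mul (GC k)
  refine squeeze_zero (fun y => by positivity) (fun y => ?_) hlim
  rw [integral_const_mul]
  by_cases hxy : ‖y - x‖ = 0
  · simp [hxy]
  · have := mul_le_mul_of_nonneg_left (key y) (inv_nonneg.2 (norm_nonneg (y - x)))
    refine this.trans (le_of_eq ?_)
    field_simp

end FD
end FY
end

section
set_option maxSynthPendingDepth 3
set_option linter.unusedSectionVars false
namespace FY
variable {E : Type*} [NormedAddCommGroup E] [NormedSpace ℝ E] [CompleteSpace E]
namespace FD
variable {f : ℝ → E → E} {k : ℝ → ℝ} {φ : ℝ → E → E} {P : ℝ → E → E →L[ℝ] E}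
    {Q : ℝ → E → E →L[ℝ] E →L[ℝ] E}

/-- error density -/
def eQ (f : ℝ → E → E) (φ : ℝ → E → E) (P : ℝ → E → E →L[ℝ] E)
    (Q : ℝ → E → E →L[ℝ] E →L[ℝ] E) (x y : E) (s : ℝ) : ℝ :=
    ‖S (D2 f s (φ s y)) (P s y) - S (D2 f s (φ s x)) (P s x)‖
      + ‖Lq (D1 f s (φ s y) - D1 f s (φ s x)) (Q s x)‖

lemma eQ0 (x y : E) (s : ℝ) : 0 ≤ eQ f φ P Q x y s := add_nonneg (norm_nonneg _) (norm_nonneg _)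

lemma meas_aux {Y Y' Z : Type*} [TopologicalSpace Y] [TopologicalSpace Y']
    [TopologicalSpace Z] {G : Y → Y' → Z} (hG : Continuous fun z : Y × Y' => G z.1 z.2)
    {a : ℝ → Y} {b : ℝ → Y'} (ha : AEStronglyMeasurable a volume)
    (hb : AEStronglyMeasurable b volume) : AEStronglyMeasurable (fun s => G (a s) (b s)) volume :=
  hG.comp_aestronglyMeasurable (ha.prodMk hb)

lemma mS (H : FD f φ P Q) (h : VF f k) (y : E) :
    AEStronglyMeasurable (fun s => S (D2 f s (φ s y)) (P s y)) volume := by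
  have h1 : AEStronglyMeasurable (fun s => D2 f s (φ s y)) volume := h.m2 _ (H.c0 y).cont
  have h2 : Continuous fun s => P s y := (H.c1 y).cont
  exact meas_aux S_cont h1 h2.aestronglyMeasurable

lemma eQ_meas (H : FD f φ P Q) (h : VF f k) (x y : E) :
    AEStronglyMeasurable (eQ f φ P Q x y) volume := by
  have h0 : AEStronglyMeasurable (fun s => D1 f s (φ s y) - D1 f s (φ s x)) volume :=
    (h.m1 _ (H.c0 y).cont).sub (h.m1 _ (H.c0 x).cont)
  have h4 : Continuous fun s => Q s x := (H.c2 x).cont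
  have h1 : AEStronglyMeasurable (fun s => Lq (D1 f s (φ s y) - D1 f s (φ s x)) (Q s x)) volume :=
    meas_aux Lq_cont h0 h4.aestronglyMeasurable
  have h2 : AEStronglyMeasurable
      (fun s => S (D2 f s (φ s y)) (P s y) - S (D2 f s (φ s x)) (P s x)) volume :=
    (mS H h y).sub (mS H h x)
  exact h2.norm.add h1.norm

/-- dominating function -/
def eQb (k : ℝ → ℝ) (s : ℝ) : ℝ := k s * (2 * (GC k * GC k) + 2 * QB k)

lemma eQb_int (h : VF f k) : Integrable (eQb k) := h.int.mul_const _

lemma eQ_le (H : FD f φ P Q) (h : VF f k) (x y : E) (s : ℝ) : ‖eQ f φ P Q x y s‖ ≤ eQb k s := by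
    rw [Real.norm_of_nonneg (eQ0 x y s)]
    have h1 : ‖S (D2 f s (φ s y)) (P s y) - S (D2 f s (φ s x)) (P s x)‖ ≤
      k s * (GC k * GC k) + k s * (GC k * GC k) :=
      (norm_sub_le _ _).trans (add_le_add (H.bS h s y) (H.bS h s x))
    have h3 : ‖D1 f s (φ s y) - D1 f s (φ s x)‖ ≤ k s + k s :=
      (norm_sub_le _ _).trans (add_le_add (h.b1 s _) (h.b1 s _))
    have h2 : ‖Lq (D1 f s (φ s y) - D1 f s (φ s x)) (Q s x)‖ ≤ (k s + k s) * QB k :=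
      (Lq_norm _ _).trans (mul_le_mul h3
        (H.bQ h s x) (norm_nonneg _) (add_nonneg (h.k0 s) (h.k0 s)))
    refine (add_le_add h1 h2).trans (le_of_eq ?_)
    unfold eQb; ring

lemma eQ_int (H : FD f φ P Q) (h : VF f k) (x y : E) : Integrable (eQ f φ P Q x y) :=
    (eQb_int h).mono' (eQ_meas H h x y) (Eventually.of_forall fun s => eQ_le H h x y s)

lemma eQ_cont (H : FD f φ P Q) (h : VF f k) (x : E) (s : ℝ) :
    Continuous fun y => eQ f φ P Q x y s := by
  have h1 : Continuous fun y => S (D2 f s (φ s y)) (P s y) :=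
    S_cont.comp (((h.cont2 s).comp (H.contφ h s)).prodMk (H.contP h s))
  have h2 : Continuous fun y => D1 f s (φ s y) :=
    ((h.cd1 s).continuous).comp (H.contφ h s)
  have h3 : Continuous fun y => D1 f s (φ s y) - D1 f s (φ s x) := h2.sub continuous_const
  have h4 : Continuous fun y => Lq (D1 f s (φ s y) - D1 f s (φ s x)) (Q s x) :=
    Lq_cont.comp (h3.prodMk continuous_const)
  have h5 : Continuous fun y => S (D2 f s (φ s y)) (P s y) - S (D2 f s (φ s x)) (P s x) :=
    h1.sub continuous_const
  exact h5.norm.add h4.norm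

lemma eQ_self (x : E) (s : ℝ) : eQ f φ P Q x x s = 0 := by
  have : Lq (0 : E →L[ℝ] E) (Q s x) = 0 := by ext; simp [Lq_apply]
  unfold eQ
  rw [sub_self, sub_self, this, norm_zero, add_zero]

lemma eQ_lim (H : FD f φ P Q) (h : VF f k) (t : ℝ) (x : E) :
    Tendsto (fun y => ∫ s in Iic t, eQ f φ P Q x y s) (𝓝 x) (𝓝 0) := by
    have : (0:ℝ) = ∫ s in Iic t, (0:ℝ) := by simp
    rw [this]
    refine tendsto_integral_filter_of_dominated_convergence (eQb k)
      (Eventually.of_forall fun y => (eQ_meas H h x y).restrict)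
      (Eventually.of_forall fun y => Eventually.of_forall fun s => eQ_le H h x y s)
      (eQb_int h).integrableOn (Eventually.of_forall fun s => ?_)
    have := (eQ_cont H h x s).tendsto x
    rwa [eQ_self] at this

lemma eQ_key (H : FD f φ P Q) (h : VF f k) (t : ℝ) (x y : E) :
    ‖Q t y - Q t x‖ ≤ GC k * ∫ s in Iic t, eQ f φ P Q x y s := by
    have := lin_gronwall (e := eQ f φ P Q x y) (t0 := t)
      (z := fun t => Q t y - Q t x) (z0 := 0)
      (h := fun s => (S (D2 f s (φ s y)) (P s y) + Lq (D1 f s (φ s y)) (Q s y))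
        - (S (D2 f s (φ s x)) (P s x) + Lq (D1 f s (φ s x)) (Q s x)))
      (B := QB k + QB k)
      h.int h.k0 ((H.c2 y).cont.sub (H.c2 x).cont)
      (fun t => (norm_sub_le _ _).trans (add_le_add (H.bQ h t y) (H.bQ h t x)))
      (eQ_int H h x y).integrableOn (fun s _ => eQ0 x y s)
      (fun s _ => ?_) (Eventually.of_forall fun s _ => ?_)
    · rwa [norm_zero, zero_add] at this
    · rw [integral_sub (H.c2 y).int.integrableOn (H.c2 x).int.integrableOn, (H.c2 y).eq s,
        (H.c2 x).eq s]
      abel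
    · have e1 : (S (D2 f s (φ s y)) (P s y) + Lq (D1 f s (φ s y)) (Q s y))
        - (S (D2 f s (φ s x)) (P s x) + Lq (D1 f s (φ s x)) (Q s x))
          = Lq (D1 f s (φ s y)) (Q s y - Q s x) +
            ((S (D2 f s (φ s y)) (P s y) - S (D2 f s (φ s x)) (P s x))
            + Lq (D1 f s (φ s y) - D1 f s (φ s x)) (Q s x)) := by
        rw [← Lq_sub_right, ← Lq_sub_left]; abel
      rw [e1]
      refine (norm_add_le _ _).trans (add_le_add ?_ (norm_add_le _ _))
      exact (Lq_norm _ _).trans (mul_le_mul_of_nonneg_right (h.b1 s _) (norm_nonneg _))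

lemma contQ (H : FD f φ P Q) (h : VF f k) (t : ℝ) : Continuous (Q t) := by
  refine continuous_iff_continuousAt.2 fun x => ?_
  have h1 : Tendsto (fun y => ‖Q t y - Q t x‖) (𝓝 x) (𝓝 0) := by
    refine squeeze_zero (fun y => norm_nonneg _) (fun y => eQ_key H h t x y) ?_
    simpa using (eQ_lim H h t x).const_mul (GC k)
  exact tendsto_iff_norm_sub_tendsto_zero.2 h1

end FD
end FY
end

section
set_option maxSynthPendingDepth 3
set_option linter.unusedSectionVars false
namespace FY
variable {E : Type*} [NormedAddCommGroup E] [NormedSpace ℝ E] [CompleteSpace E] [ProperSpace E]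
namespace FD
variable {f : ℝ → E → E} {k : ℝ → ℝ} {φ : ℝ → E → E} {P : ℝ → E → E →L[ℝ] E}
    {Q : ℝ → E → E →L[ℝ] E →L[ℝ] E}

lemma cocompact_cg : (cocompact E).IsCountablyGenerated := by
  rw [← Metric.cobounded_eq_cocompact, ← comap_norm_atTop]
  infer_instance

lemma decay_gen {Y : Type*} [NormedAddCommGroup Y] [NormedSpace ℝ Y] {F : E → ℝ → Y} {b : ℝ → ℝ}
    (hb : Integrable b) (hm : ∀ x, AEStronglyMeasurable (F x) volume)
    (hF : ∀ x s, ‖F x s‖ ≤ b s) (hl : ∀ s, Tendsto (fun x => F x s) (cocompact E) (𝓝 0)) (t : ℝ) :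
    Tendsto (fun x => ∫ s in Iic t, F x s) (cocompact E) (𝓝 0) := by
  have := cocompact_cg (E := E)
  have h0 : (0:Y) = ∫ s in Iic t, (0:Y) := by simp
  rw [h0]
  exact tendsto_integral_filter_of_dominated_convergence b
      (Eventually.of_forall fun y => (hm y).restrict)
      (Eventually.of_forall fun y => Eventually.of_forall fun s => hF y s)
      hb.integrableOn (Eventually.of_forall hl)

lemma φ_sub (H : FD f φ P Q) (h : VF f k) (t : ℝ) (x : E) : ‖φ t x - x‖ ≤ ∫ s, k s :=
  ((H.c0 x).sub0_le h.int (fun s => h.b0 s _) t).trans (prim_le h.int h.k0 t)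

lemma φ_cocompact (H : FD f φ P Q) (h : VF f k) (t : ℝ) :
    Tendsto (φ t) (cocompact E) (cocompact E) := by
  rw [← Metric.cobounded_eq_cocompact, ← tendsto_norm_atTop_iff_cobounded]
  refine tendsto_atTop_mono (f := fun x => ‖x‖ - ∫ s, k s) (fun x => ?_)
    (tendsto_atTop_add_const_right _ _ tendsto_norm_cobounded_atTop)
  have h1 := H.φ_sub h t x
  have h2 := norm_sub_norm_le x (φ t x)
  rw [norm_sub_rev] at h2
  linarith

lemma decay0 (H : FD f φ P Q) (h : VF f k) (t : ℝ) :
    Tendsto (fun x => φ t x - x) (cocompact E) (𝓝 0) := by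
  have := decay_gen (F := fun x s => f s (φ s x)) h.int (fun x => h.m0 _ (H.c0 x).cont)
    (fun x s => h.b0 s _) (fun s => (h.d0 s).comp (H.φ_cocompact h s)) t
  refine this.congr fun x => ?_
  rw [(H.c0 x).eq t, add_sub_cancel_left]

lemma b1c (H : FD f φ P Q) (h : VF f k) (s : ℝ) (x : E) :
    ‖(D1 f s (φ s x)).comp (P s x)‖ ≤ k s * GC k :=
  (ContinuousLinearMap.opNorm_comp_le _ _).trans
    (mul_le_mul (h.b1 s _) (H.bP h s x) (norm_nonneg _) (h.k0 s))

lemma decay1 (H : FD f φ P Q) (h : VF f k) (t : ℝ) :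
    Tendsto (fun x => P t x - ContinuousLinearMap.id ℝ E) (cocompact E) (𝓝 0) := by
  have := decay_gen (F := fun x s => (D1 f s (φ s x)).comp (P s x)) (h.int.mul_const (GC k))
    (fun x => (H.c1 x).int.aestronglyMeasurable)
    (fun x s => H.b1c h s x) (fun s => ?_) t
  · refine this.congr fun x => ?_
    rw [(H.c1 x).eq t, add_sub_cancel_left]
  · have h1 : Tendsto (fun x => ‖D1 f s (φ s x)‖ * GC k) (cocompact E) (𝓝 0) := by
      simpa using (((h.d1 s).comp (H.φ_cocompact h s)).norm.mul_const (GC k))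
    refine squeeze_zero_norm (fun x => ?_) h1
    exact (ContinuousLinearMap.opNorm_comp_le _ _).trans
      (mul_le_mul_of_nonneg_left (H.bP h s x) (norm_nonneg _))

lemma b2c (H : FD f φ P Q) (h : VF f k) (s : ℝ) (x : E) :
    ‖S (D2 f s (φ s x)) (P s x) + Lq (D1 f s (φ s x)) (Q s x)‖ ≤ k s * (GC k * GC k + QB k) := by
  rw [mul_add]
  exact (norm_add_le _ _).trans (add_le_add (H.bS h s x) ((Lq_norm _ _).trans
    (mul_le_mul (h.b1 s _) (H.bQ h s x) (norm_nonneg _) (h.k0 s))))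

lemma decay2 (H : FD f φ P Q) (h : VF f k) (t : ℝ) :
    Tendsto (fun x => Q t x) (cocompact E) (𝓝 0) := by
  have := decay_gen (F := fun x s => S (D2 f s (φ s x)) (P s x) + Lq (D1 f s (φ s x)) (Q s x))
    (h.int.mul_const (GC k * GC k + QB k))
    (fun x => (H.c2 x).int.aestronglyMeasurable)
    (fun x s => H.b2c h s x) (fun s => ?_) t
  · refine this.congr fun x => ?_
    rw [(H.c2 x).eq t, zero_add]
  · have h1 : Tendsto (fun x => ‖D2 f s (φ s x)‖ * (GC k * GC k)) (cocompact E) (𝓝 0) := by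
      simpa using (((h.d2 s).comp (H.φ_cocompact h s)).norm.mul_const (GC k * GC k))
    have h2 : Tendsto (fun x => ‖D1 f s (φ s x)‖ * QB k) (cocompact E) (𝓝 0) := by
      simpa using (((h.d1 s).comp (H.φ_cocompact h s)).norm.mul_const (QB k))
    have h3 := h1.add h2
    rw [add_zero] at h3
    refine squeeze_zero_norm (fun x => ?_) h3
    refine (norm_add_le _ _).trans (add_le_add ((S_norm _ _).trans ?_) ((Lq_norm _ _).trans ?_))
    · exact mul_le_mul_of_nonneg_left (mul_le_mul (H.bP h s x) (H.bP h s x)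
        (norm_nonneg _) (GC_nonneg k)) (norm_nonneg _)
    · exact mul_le_mul_of_nonneg_left (H.bQ h s x) (norm_nonneg _)

lemma t0 (H : FD f φ P Q) (h : VF f k) {t' t : ℝ} (ht : t' ≤ t) (x : E) :
    ‖φ t x - φ t' x‖ ≤ ∫ s in Ioc t' t, k s :=
  (H.c0 x).sub_le h.int (fun s => h.b0 s _) ht

lemma t1 (H : FD f φ P Q) (h : VF f k) {t' t : ℝ} (ht : t' ≤ t) (x : E) :
    ‖P t x - P t' x‖ ≤ (∫ s in Ioc t' t, k s) * GC k := by
  rw [← integral_mul_const]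
  exact (H.c1 x).sub_le (h.int.mul_const _) (fun s => H.b1c h s x) ht

lemma t2 (H : FD f φ P Q) (h : VF f k) {t' t : ℝ} (ht : t' ≤ t) (x : E) :
    ‖Q t x - Q t' x‖ ≤ (∫ s in Ioc t' t, k s) * (GC k * GC k + QB k) := by
  rw [← integral_mul_const]
  exact (H.c2 x).sub_le (h.int.mul_const _) (fun s => H.b2c h s x) ht

lemma inv_aux {f' : ℝ → E → E} {k' : ℝ → ℝ} {φ' : ℝ → E → E} {P' : ℝ → E → E →L[ℝ] E}
    {Q' : ℝ → E → E →L[ℝ] E →L[ℝ] E} (H : FD f φ P Q)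
    (H' : FD f' φ' P' Q') (h' : VF f' k') {a : ℝ} (hrev : ∀ s x, f' s x = - f (a - s) x)
    (hs : ∀ s, s ∉ Icc 0 a → f s = 0) (x : E) : φ' a (φ a x) = x := by
  have hi : Integrable fun s => f s (φ s x) := (H.c0 x).int
  have hi2 : Integrable fun s => f' s (φ (a - s) x) := by
    simp only [hrev]
    exact (hi.comp_sub_left a).neg
  have hc : IsCrv f' (φ a x) (fun s => φ (a - s) x) := by
    refine ⟨(H.c0 x).cont.comp (continuous_const.sub continuous_id), ?_, hi2, fun t => ?_⟩
    · obtain ⟨B, hB⟩ := (H.c0 x).bdd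
      exact ⟨B, fun t => hB _⟩
    · have e1 : (∫ s in Iic t, f' s (φ (a - s) x)) = - ∫ s in Ioi (a - t), f s (φ s x) := by
        simp only [hrev]
        rw [integral_neg, ← integral_Ici_eq_integral_Ioi]
        congr 1
        rw [← integral_indicator measurableSet_Iic, ← integral_indicator measurableSet_Ici,
          ← integral_sub_left_eq_self _ volume a]
        congr 1
        ext s
        by_cases hst : a - s ≤ t
        · rw [indicator_of_mem (mem_Iic.2 hst), indicator_of_mem (mem_Ici.2 (by linarith)),
            sub_sub_cancel]
        · rw [indicator_of_notMem (mem_Iic.not.2 hst), indicator_of_notMem (fun hh =>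
            hst (by have := mem_Ici.1 hh; linarith))]
      have e2 : (∫ s in Ioi a, f s (φ s x)) = 0 := by
        refine setIntegral_eq_zero_of_forall_eq_zero fun s hsa => ?_
        rw [hs s (fun hh => absurd hh.2 (not_le.2 hsa))]; rfl
      have e3 := intervalIntegral.integral_Iic_add_Ioi (μ := volume) (b := a) hi.integrableOn hi.integrableOn
      have e4 := intervalIntegral.integral_Iic_add_Ioi (μ := volume) (b := a - t) hi.integrableOn hi.integrableOn
      rw [e2, add_zero] at e3
      rw [e1, (H.c0 x).eq (a - t), (H.c0 x).eq a, e3, ← e4]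
      abel
  have h1 := cmp0 (d := fun _ => 0) (t := a) h' (H'.c0 (φ a x)) hc (by simp) (by simp)
    (Eventually.of_forall fun s _ x => by simp)
  simp only [sub_self, norm_zero, integral_zero, add_zero, mul_zero, norm_le_zero_iff] at h1
  rw [sub_eq_zero.1 h1, (H.c0 x).eq 0, integral_Iic_eq_integral_Iio]
  have e2 : (∫ s in Iio 0, f s (φ s x)) = 0 := by
    refine setIntegral_eq_zero_of_forall_eq_zero fun s hsa => ?_
    rw [hs s (fun hh => absurd hh.1 (not_le.2 hsa))]; rfl
  rw [e2, add_zero]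

end FD

lemma VF.rev {f : ℝ → E → E} {k : ℝ → ℝ} (h : VF f k) (a : ℝ) :
    VF (fun s x => - f (a - s) x) (fun s => k (a - s)) := by
  have e1 : ∀ s, D1 (fun s x => - f (a - s) x) s = fun x => - D1 f (a - s) x := by
    intro s; ext1 x; exact fderiv_fun_neg
  have e2 : ∀ s, D2 (fun s x => - f (a - s) x) s = fun x => - D2 f (a - s) x := by
    intro s; ext1 x
    have : fderiv ℝ (fun x => - f (a - s) x) = fun x => - D1 f (a - s) x := e1 s
    simp only [D2]
    rw [this]; exact fderiv_fun_neg
  have hq : Measure.QuasiMeasurePreserving (fun s : ℝ => a - s) volume volume :=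
    (Measure.measurePreserving_sub_left volume a).quasiMeasurePreserving
  have hy : ∀ y : ℝ → E, Continuous y → Continuous fun s => y (a - s) := fun y hy =>
    hy.comp (continuous_const.sub continuous_id)
  refine ⟨h.int.comp_sub_left a, fun s => (h.smooth _).neg, fun s x => ?_, fun s x => ?_,
    fun s x => ?_, fun s => ?_, fun s => ?_, fun s => ?_, fun y hyc => ?_, fun y hyc => ?_,
    fun y hyc => ?_⟩
  · rw [norm_neg]; exact h.b0 _ _
  · rw [e1, norm_neg]; exact h.b1 _ _
  · rw [e2, norm_neg]; exact h.b2 _ _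
  · simpa using (h.d0 (a - s)).neg
  · rw [e1]; simpa using (h.d1 (a - s)).neg
  · rw [e2]; simpa using (h.d2 (a - s)).neg
  · have := ((h.m0 _ (hy y hyc)).comp_quasiMeasurePreserving hq).neg
    refine this.congr (Eventually.of_forall fun s => ?_)
    simp
  · have := ((h.m1 _ (hy y hyc)).comp_quasiMeasurePreserving hq).neg
    refine this.congr (Eventually.of_forall fun s => ?_)
    simp [e1]
  · have := ((h.m2 _ (hy y hyc)).comp_quasiMeasurePreserving hq).neg
    refine this.congr (Eventually.of_forall fun s => ?_)
    simp [e2]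

end FY
end

section
set_option maxSynthPendingDepth 3
set_option linter.unusedSectionVars false
namespace FY

lemma ifd0 (w : E3 → E3) (x : E3) : ‖iteratedFDeriv ℝ 0 w x‖ = ‖w x‖ := norm_iteratedFDeriv_zero
lemma ifd1 (w : E3 → E3) (x : E3) : ‖iteratedFDeriv ℝ 1 w x‖ = ‖fderiv ℝ w x‖ :=
  norm_iteratedFDeriv_one w
lemma ifd2 (w : E3 → E3) (x : E3) : ‖iteratedFDeriv ℝ 2 w x‖ = ‖fderiv ℝ (fderiv ℝ w) x‖ := by
  rw [← norm_iteratedFDeriv_one (𝕜 := ℝ) (fderiv ℝ w), norm_iteratedFDeriv_fderiv]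

lemma normS1 (w : E3 → E3) : normS 1 w = supDeriv 0 w + supDeriv 1 w := by
  simp [normS, Finset.sum_range_succ]
lemma normS2 (w : E3 → E3) : normS 2 w = supDeriv 0 w + supDeriv 1 w + supDeriv 2 w := by
  simp [normS, Finset.sum_range_succ]
lemma supDeriv_nonneg (k : ℕ) (w : E3 → E3) : 0 ≤ supDeriv k w :=
  Real.iSup_nonneg fun _ => norm_nonneg _
lemma normS_nonneg (k : ℕ) (w : E3 → E3) : 0 ≤ normS k w :=
  Finset.sum_nonneg fun _ _ => supDeriv_nonneg _ _
lemma normS12 (w : E3 → E3) : normS 1 w ≤ normS 2 w := by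
  rw [normS1, normS2]; linarith [supDeriv_nonneg 2 w]

lemma memC0_bdd {s k : ℕ} {w : E3 → E3} (h : MemC0 s w) (hk : k ≤ s) (x : E3) :
    ‖iteratedFDeriv ℝ k w x‖ ≤ supDeriv k w := by
  have hc : Continuous fun x => iteratedFDeriv ℝ k w x :=
    h.1.continuous_iteratedFDeriv (by exact_mod_cast hk)
  have h0 : ∃ y, ∀ x, ‖iteratedFDeriv ℝ k w x‖ ≤ y := by
    obtain ⟨K, hK, hK1⟩ := mem_cocompact.1 ((h.2 k hk).eventually_le_const zero_lt_one)
    obtain ⟨B, hB⟩ := (hK.image hc.norm).bddAbove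
    refine ⟨max B 1, fun x => ?_⟩
    by_cases hx : x ∈ K
    · exact (hB ⟨x, hx, rfl⟩).trans (le_max_left _ _)
    · exact (hK1 hx).trans (le_max_right _ _)
  obtain ⟨y, hy⟩ := h0
  exact le_ciSup (f := fun x => ‖iteratedFDeriv ℝ k w x‖) ⟨y, by rintro _ ⟨x, rfl⟩; exact hy x⟩ x

lemma memC0_le {s k : ℕ} {w : E3 → E3} (h : MemC0 s w) (hk : k ≤ s) (x : E3) :
    ‖iteratedFDeriv ℝ k w x‖ ≤ normS s w :=
  (memC0_bdd h hk x).trans (Finset.single_le_sum (f := fun k => supDeriv k w)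
    (fun _ _ => supDeriv_nonneg _ _) (by simp; omega))

lemma MemC0.to1 {w : E3 → E3} (h : MemC0 2 w) : MemC0 1 w :=
  ⟨h.1.of_le (by norm_num), fun k hk => h.2 k (by omega)⟩

lemma normS1_le {w : E3 → E3} {p : E3 → E3 →L[ℝ] E3} (hp : ∀ x, HasFDerivAt w (p x) x)
    {a b : ℝ} (ha : ∀ x, ‖w x‖ ≤ a) (hb : ∀ x, ‖p x‖ ≤ b) : normS 1 w ≤ a + b := by
  rw [normS1]
  refine add_le_add (ciSup_le fun x => ?_) (ciSup_le fun x => ?_)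
  · rw [ifd0]; exact ha x
  · rw [ifd1, (hp x).fderiv]; exact hb x

lemma normS2_le {w : E3 → E3} {p : E3 → E3 →L[ℝ] E3} {q : E3 → E3 →L[ℝ] E3 →L[ℝ] E3}
    (hp : ∀ x, HasFDerivAt w (p x) x) (hq : ∀ x, HasFDerivAt p (q x) x)
    {a b c : ℝ} (ha : ∀ x, ‖w x‖ ≤ a) (hb : ∀ x, ‖p x‖ ≤ b) (hc : ∀ x, ‖q x‖ ≤ c) :
    normS 2 w ≤ a + b + c := by
  have : fderiv ℝ w = p := funext fun x => (hp x).fderiv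
  rw [normS2]
  refine add_le_add (add_le_add (ciSup_le fun x => ?_) (ciSup_le fun x => ?_)) (ciSup_le fun x => ?_)
  · rw [ifd0]; exact ha x
  · rw [ifd1, (hp x).fderiv]; exact hb x
  · rw [ifd2, this, (hq x).fderiv]; exact hc x

lemma memC0_of {w : E3 → E3} {p : E3 → E3 →L[ℝ] E3} {q : E3 → E3 →L[ℝ] E3 →L[ℝ] E3}
    (hp : ∀ x, HasFDerivAt w (p x) x) (hq : ∀ x, HasFDerivAt p (q x) x) (hc : Continuous q)
    (h0 : Tendsto w (cocompact E3) (𝓝 0)) (h1 : Tendsto p (cocompact E3) (𝓝 0))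
    (h2 : Tendsto q (cocompact E3) (𝓝 0)) : MemC0 2 w := by
  have e1 : fderiv ℝ w = p := funext fun x => (hp x).fderiv
  have e2 : fderiv ℝ p = q := funext fun x => (hq x).fderiv
  refine ⟨?_, fun k hk => ?_⟩
  · have : ContDiff ℝ (1 + 1) w := by
      rw [contDiff_succ_iff_fderiv]
      refine ⟨fun x => (hp x).differentiableAt, by simp, ?_⟩
      rw [e1, contDiff_one_iff_fderiv, e2]
      exact ⟨fun x => (hq x).differentiableAt, hc⟩
    exact this.of_le (by norm_num)
  · interval_cases k
    · simp only [ifd0]; simpa using h0.norm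
    · simp only [ifd1, e1]; simpa using h1.norm
    · simp only [ifd2, e1, e2]; simpa using h2.norm

/-- extensionality -/
lemma DiffId.ext' {s : ℕ} {Φ Ψ : DiffId s} (h : ∀ x, Φ x = Ψ x) : Φ = Ψ := by
  obtain ⟨a, b, l, r, m, m'⟩ := Φ
  obtain ⟨a', b', l', r', n, n'⟩ := Ψ
  obtain rfl : a = a' := funext h
  obtain rfl : b = b' := by
    ext1 x
    have : a (b x) = a (b' x) := (r x).trans (r' x).symm
    have := congrArg b this
    rwa [l, l] at this
  rfl

section flow
variable {f : ℝ → E3 → E3} {k : ℝ → ℝ} {φ : ℝ → E3 → E3} {P : ℝ → E3 → E3 →L[ℝ] E3}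
    {Q : ℝ → E3 → E3 →L[ℝ] E3 →L[ℝ] E3}

lemma FD.memC0 (H : FD f φ P Q) (h : VF f k) (t : ℝ) : MemC0 2 fun x => φ t x - x :=
  memC0_of (p := fun x => P t x - ContinuousLinearMap.id ℝ E3) (q := Q t)
    (fun x => (H.derivφ h t x).sub (hasFDerivAt_id x))
    (fun x => (H.derivP h t x).sub_const _) (H.contQ h t) (H.decay0 h t) (H.decay1 h t)
    (H.decay2 h t)

/-- time modulus constant -/
def CT (k : ℝ → ℝ) : ℝ := 1 + GC k + (GC k * GC k + FD.QB k)

lemma FD.time (H : FD f φ P Q) (h : VF f k) {t' t : ℝ} (ht : t' ≤ t) :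
    normS 2 (fun x => φ t x - φ t' x) ≤ CT k * ∫ s in Ioc t' t, k s := by
  refine (normS2_le (fun x => (H.derivφ h t x).sub (H.derivφ h t' x))
    (fun x => (H.derivP h t x).sub (H.derivP h t' x)) (H.t0 h ht) (H.t1 h ht)
    (H.t2 h ht)).trans (le_of_eq ?_)
  unfold CT; ring

/-- comparison constant -/
def CD (k : ℝ → ℝ) : ℝ := GC k + GC k * (GC k * (GC k * (∫ s, k s) + 1))

lemma FD.dist {f' : ℝ → E3 → E3} {φ' : ℝ → E3 → E3} {P' : ℝ → E3 → E3 →L[ℝ] E3}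
    {Q' : ℝ → E3 → E3 →L[ℝ] E3 →L[ℝ] E3} (H : FD f φ P Q) (h : VF f k)
    (H' : FD f' φ' P' Q') (h' : VF f' k) {d : ℝ → ℝ} (hd : Integrable d) (hd0 : ∀ s, 0 ≤ d s)
    {t : ℝ} (hff : ∀ᵐ s, s ≤ t → ∀ x, ‖f s x - f' s x‖ ≤ d s)
    (hff' : ∀ᵐ s, s ≤ t → ∀ x, ‖D1 f s x - D1 f' s x‖ ≤ d s) :
    normS 1 (fun x => φ t x - φ' t x) ≤ CD k * ∫ s in Iic t, d s := by
  have h0 : ∀ x, ∀ s ≤ t, ‖φ s x - φ' s x‖ ≤ GC k * ∫ s in Iic t, d s := by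
    intro x s hs
    have := cmp0 (t := s) h (H.c0 x) (H'.c0 x) hd hd0
      (hff.mono fun r hr hrs => hr (hrs.trans hs))
    rw [sub_self, norm_zero, zero_add] at this
    exact this.trans (mul_le_mul_of_nonneg_left (prim_mono hd hd0 hs) (GC_nonneg k))
  refine (normS1_le (fun x => (H.derivφ h t x).sub (H'.derivφ h' t x)) (fun x => h0 x t le_rfl)
    (fun x => cmp1 h h' (H.c1 x) (H'.c1 x) hd hd0 (h0 x) hff')).trans (le_of_eq ?_)
  unfold CD; ring

end flow
end FY
end

section
set_option maxSynthPendingDepth 3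
set_option linter.unusedSectionVars false
namespace FY
variable {V : Type*} [NormedAddCommGroup V] [InnerProductSpace ℝ V]

/-- standing assumptions on the embedding -/
structure EmbOK (emb : V →ₗ[ℝ] (E3 → E3)) (cV : ℝ) : Prop where
  pos : 0 < cV
  c0 : ∀ u : V, MemC0 2 (emb u)
  bd : ∀ u : V, normS 2 (emb u) ≤ cV * ‖u‖

variable {emb : V →ₗ[ℝ] (E3 → E3)} {cV : ℝ}
namespace EmbOK

lemma u0 (h : EmbOK emb cV) (u : V) (x : E3) : ‖emb u x‖ ≤ cV * ‖u‖ := by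
  rw [← ifd0]; exact (memC0_le (h.c0 u) (by norm_num) x).trans (h.bd u)
lemma u1 (h : EmbOK emb cV) (u : V) (x : E3) : ‖fderiv ℝ (emb u) x‖ ≤ cV * ‖u‖ := by
  rw [← ifd1]; exact (memC0_le (h.c0 u) (by norm_num) x).trans (h.bd u)
lemma u2 (h : EmbOK emb cV) (u : V) (x : E3) : ‖fderiv ℝ (fderiv ℝ (emb u)) x‖ ≤ cV * ‖u‖ := by
  rw [← ifd2]; exact (memC0_le (h.c0 u) (by norm_num) x).trans (h.bd u)

lemma cd (h : EmbOK emb cV) (u : V) : ContDiff ℝ 2 (emb u) := by exact_mod_cast (h.c0 u).1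
lemma cd1 (h : EmbOK emb cV) (u : V) : ContDiff ℝ 1 (fderiv ℝ (emb u)) :=
  (h.cd u).fderiv_right (by norm_num)
lemma df0 (h : EmbOK emb cV) (u : V) : Differentiable ℝ (emb u) :=
  (h.cd u).differentiable (by norm_num)
lemma df1 (h : EmbOK emb cV) (u : V) : Differentiable ℝ (fderiv ℝ (emb u)) :=
  (h.cd1 u).differentiable (by norm_num)

lemma s1 (h : EmbOK emb cV) (u w : V) :
    fderiv ℝ (emb (u - w)) = fun x => fderiv ℝ (emb u) x - fderiv ℝ (emb w) x := by
  ext1 x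
  rw [map_sub]
  exact fderiv_sub (h.df0 u x) (h.df0 w x)
lemma s2 (h : EmbOK emb cV) (u w : V) (x : E3) :
    fderiv ℝ (fderiv ℝ (emb (u - w))) x
      = fderiv ℝ (fderiv ℝ (emb u)) x - fderiv ℝ (fderiv ℝ (emb w)) x := by
  rw [h.s1]
  exact fderiv_fun_sub (h.df1 u x) (h.df1 w x)

lemma l0 (h : EmbOK emb cV) (u w : V) (x : E3) : ‖emb u x - emb w x‖ ≤ cV * ‖u - w‖ := by
  have := h.u0 (u - w) x
  rwa [map_sub] at this
lemma l1 (h : EmbOK emb cV) (u w : V) (x : E3) :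
    ‖fderiv ℝ (emb u) x - fderiv ℝ (emb w) x‖ ≤ cV * ‖u - w‖ := by
  have := h.u1 (u - w) x
  rwa [h.s1] at this
lemma l2 (h : EmbOK emb cV) (u w : V) (x : E3) :
    ‖fderiv ℝ (fderiv ℝ (emb u)) x - fderiv ℝ (fderiv ℝ (emb w)) x‖ ≤ cV * ‖u - w‖ := by
  have := h.u2 (u - w) x
  rwa [h.s2] at this

lemma jc {Y : Type*} [NormedAddCommGroup Y] {G : V → E3 → Y} {c : ℝ} (hc : 0 ≤ c)
    (hG : ∀ u w x, ‖G u x - G w x‖ ≤ c * ‖u - w‖) (hGc : ∀ u, Continuous (G u)) :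
    Continuous fun z : V × E3 => G z.1 z.2 := by
  refine continuous_prod_of_continuous_lipschitzWith _ (Real.toNNReal c) hGc fun x => ?_
  refine LipschitzWith.of_dist_le_mul fun u w => ?_
  rw [dist_eq_norm, dist_eq_norm, Real.coe_toNNReal _ hc]
  exact hG u w x

lemma jm {Y : Type*} [NormedAddCommGroup Y] {G : V → E3 → Y} {c : ℝ} (hc : 0 ≤ c)
    (hG : ∀ u w x, ‖G u x - G w x‖ ≤ c * ‖u - w‖) (hGc : ∀ u, Continuous (G u)) {v : ℝ → V}
    (hv : AEStronglyMeasurable v volume) (y : ℝ → E3) (hy : Continuous y) :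
    AEStronglyMeasurable (fun s => G (v s) (y s)) volume :=
  (jc hc hG hGc).comp_aestronglyMeasurable (hv.prodMk hy.aestronglyMeasurable)

lemma vf (h : EmbOK emb cV) {v : ℝ → V} (hv : AEStronglyMeasurable v volume) {k : ℝ → ℝ}
    (hk : Integrable k) (hb : ∀ s, cV * ‖v s‖ ≤ k s) : VF (fun s => emb (v s)) k := by
  refine ⟨hk, fun s => h.cd _, fun s x => (h.u0 _ x).trans (hb s), fun s x => (h.u1 _ x).trans (hb s),
    fun s x => (h.u2 _ x).trans (hb s), fun s => ?_, fun s => ?_, fun s => ?_,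
    jm h.pos.le h.l0 (fun u => (h.df0 u).continuous) hv,
    jm (G := fun u => fderiv ℝ (emb u)) h.pos.le h.l1 (fun u => (h.df1 u).continuous) hv,
    jm (G := fun u => fderiv ℝ (fderiv ℝ (emb u))) h.pos.le h.l2
      (fun u => (h.cd1 u).continuous_fderiv (by norm_num)) hv⟩
  · refine tendsto_zero_iff_norm_tendsto_zero.2 ?_
    simpa only [ifd0] using (h.c0 (v s)).2 0 (by norm_num)
  · refine tendsto_zero_iff_norm_tendsto_zero.2 ?_
    simpa only [ifd1] using (h.c0 (v s)).2 1 (by norm_num)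
  · refine tendsto_zero_iff_norm_tendsto_zero.2 ?_
    simpa only [ifd2] using (h.c0 (v s)).2 2 (by norm_num)

end EmbOK

/-- admissible velocities -/
structure Adm (cV : ℝ) (k : ℝ → ℝ) (v : ℝ → V) : Prop where
  meas : AEStronglyMeasurable v volume
  int : Integrable k
  bd : ∀ s, cV * ‖v s‖ ≤ k s
  supp : ∀ s < 0, v s = 0

/-- flows of velocities -/
def IsFlow (emb : V →ₗ[ℝ] (E3 → E3)) (v : ℝ → V) (Φ : ℝ → DiffId 1) : Prop :=
  ∃ P Q, FD (fun s => emb (v s)) (fun t => Φ t) P Q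

lemma Adm.vf {k : ℝ → ℝ} {v : ℝ → V} (hv : Adm cV k v) (h : EmbOK emb cV) :
    VF (fun s => emb (v s)) k := h.vf hv.meas hv.int hv.bd

lemma Adm.inv {k : ℝ → ℝ} {v : ℝ → V} (hv : Adm cV k v) (h : EmbOK emb cV)
    {φ : ℝ → E3 → E3} {P : ℝ → E3 → E3 →L[ℝ] E3}
    {Q : ℝ → E3 → E3 →L[ℝ] E3 →L[ℝ] E3} (H : FD (fun s => emb (v s)) φ P Q) (t : ℝ) :
    ∃ ψ : E3 → E3, Function.LeftInverse ψ (φ t) ∧ Function.RightInverse ψ (φ t) ∧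
      MemC0 2 fun x => ψ x - x := by
  let w : ℝ → V := (Iic t).indicator v
  have hw : ∀ s, cV * ‖w s‖ ≤ k s := fun s =>
    (mul_le_mul_of_nonneg_left (norm_indicator_le_norm_self _ _) h.pos.le).trans (hv.bd s)
  have h1 : VF (fun s => emb (w s)) k := h.vf (hv.meas.indicator measurableSet_Iic) hv.int hw
  have h2 := h1.rev t
  obtain ⟨φ1, P1, Q1, H1⟩ := exists_flow h1
  obtain ⟨φ2, P2, Q2, H2⟩ := exists_flow h2
  have e : ∀ x, φ1 t x = φ t x := by
    intro x
    have := cmp0 (d := fun _ => 0) (t := t) h1 (H1.c0 x) (H.c0 x) (by simp) (by simp)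
      (Eventually.of_forall fun s hs x => by
        simp only [w]; rw [indicator_of_mem (mem_Iic.2 hs), sub_self, norm_zero])
    simp only [sub_self, norm_zero, integral_zero, add_zero, mul_zero, norm_le_zero_iff] at this
    exact sub_eq_zero.1 this
  have z1 : ∀ s, s ∉ Icc 0 t → emb (w s) = 0 := by
    intro s hs
    have : w s = 0 := by
      by_cases hst : s ≤ t
      · have : s < 0 := by
          by_contra h0
          exact hs ⟨not_lt.1 h0, hst⟩
        simp only [w]; rw [indicator_of_mem (mem_Iic.2 hst), hv.supp s this]
      · exact indicator_of_notMem (by simpa using hst) _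
    rw [this, map_zero]
  refine ⟨φ2 t, fun x => ?_, fun x => ?_, H2.memC0 h2 t⟩
  · rw [← e]
    exact FD.inv_aux H1 H2 h2 (fun s x => rfl) z1 x
  · rw [← e]
    refine FD.inv_aux H2 H1 h1 (fun s x => ?_) (fun s hs => ?_) x
    · simp
    · ext1 x
      rw [z1 (t - s) (fun hh => hs ⟨by linarith [hh.2], by linarith [hh.1]⟩)]
      simp

lemma Adm.exists_flow {k : ℝ → ℝ} {v : ℝ → V} (hv : Adm cV k v) (h : EmbOK emb cV) :
    ∃ Φ, IsFlow emb v Φ := by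
  obtain ⟨φ, P, Q, H⟩ := FY.exists_flow (hv.vf h)
  choose ψ h1 h2 h3 using fun t => hv.inv h H t
  exact ⟨fun t => ⟨φ t, ψ t, h1 t, h2 t, MemC0.to1 (H.memC0 (hv.vf h) t), MemC0.to1 (h3 t)⟩, P, Q, H⟩

namespace IsFlow
variable {k : ℝ → ℝ} {v w : ℝ → V} {Φ Ψ : ℝ → DiffId 1}

lemma memC0 (H : IsFlow emb v Φ) (hv : Adm cV k v) (h : EmbOK emb cV) (t : ℝ) :
    MemC0 2 fun x => Φ t x - x := by
  obtain ⟨P, Q, H⟩ := H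
  exact H.memC0 (hv.vf h) t

lemma time (H : IsFlow emb v Φ) (hv : Adm cV k v) (h : EmbOK emb cV) {t' t : ℝ} (ht : t' ≤ t) :
    normS 2 (fun x => Φ t x - Φ t' x) ≤ CT k * ∫ s in Ioc t' t, k s := by
  obtain ⟨P, Q, H⟩ := H
  exact H.time (hv.vf h) ht

lemma dist (H : IsFlow emb v Φ) (hv : Adm cV k v) (H' : IsFlow emb w Ψ) (hw : Adm cV k w)
    (h : EmbOK emb cV) {d : ℝ → ℝ} (hd : Integrable d) (hd0 : ∀ s, 0 ≤ d s) {t : ℝ}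
    (hvw : ∀ᵐ s, s ≤ t → cV * ‖v s - w s‖ ≤ d s) :
    distS 1 (Φ t) (Ψ t) ≤ CD k * ∫ s in Iic t, d s := by
  obtain ⟨P, Q, H⟩ := H
  obtain ⟨P', Q', H'⟩ := H'
  exact H.dist (hv.vf h) H' (hw.vf h) hd hd0
    (hvw.mono fun s hs hst x => (h.l0 _ _ x).trans (hs hst))
    (hvw.mono fun s hs hst x => (h.l1 _ _ x).trans (hs hst))

lemma eq_of_ae (H : IsFlow emb v Φ) (hv : Adm cV k v) (H' : IsFlow emb w Ψ)
    {t : ℝ} (h : EmbOK emb cV) (hvw : ∀ᵐ s, s ≤ t → v s = w s) : Φ t = Ψ t := by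
  obtain ⟨P, Q, H⟩ := H
  obtain ⟨P', Q', H'⟩ := H'
  refine DiffId.ext' fun x => ?_
  have := cmp0 (d := fun _ => 0) (t := t) (hv.vf h) (H.c0 x) (H'.c0 x) (by simp) (by simp)
      (hvw.mono fun s hs hst x => by rw [hs hst, sub_self, norm_zero])
  simp only [sub_self, norm_zero, integral_zero, add_zero, mul_zero, norm_le_zero_iff] at this
  exact sub_eq_zero.1 this

end IsFlow
end FY
end

section
set_option maxSynthPendingDepth 3
set_option linter.unusedSectionVars false
namespace FY
variable {V : Type*} [NormedAddCommGroup V]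

/-- dominated measurable functions -/
structure Dom (k : ℝ → ℝ) (v : ℝ → V) : Prop where
  meas : AEStronglyMeasurable v volume
  bd : ∀ s, ‖v s‖ ≤ k s

/-- causal locally contracting maps -/
structure Caus (k : ℝ → ℝ) (Γ : (ℝ → V) → ℝ → V) : Prop where
  int : Integrable k
  neg : ∀ s < 0, k s = 0
  maps : ∀ v, Dom k v → Dom k (Γ v)
  lip : ∀ v, Dom k v → ∀ t0, ∃ ε > 0, ∃ M ≥ 0, ∀ w w', Dom k w → Dom k w' →
    (∀ᵐ s, s ≤ t0 → w s = v s) → (∀ᵐ s, s ≤ t0 → w' s = v s) → ∀ s ≤ t0 + ε,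
      ‖Γ w s - Γ w' s‖ ≤ M * k s * ∫ r in Iic s, ‖w r - w' r‖

variable {k : ℝ → ℝ} {Γ : (ℝ → V) → ℝ → V} {v w : ℝ → V}

lemma Dom.k0 (h : Dom k v) (s : ℝ) : 0 ≤ k s := (norm_nonneg _).trans (h.bd s)

lemma Dom.sub_int (hk : Integrable k) (hv : Dom k v) (hw : Dom k w) :
    Integrable fun s => ‖v s - w s‖ :=
  (hk.add hk).mono' (hv.meas.sub hw.meas).norm (Eventually.of_forall fun s => by
    rw [norm_norm]; exact (norm_sub_le _ _).trans (add_le_add (hv.bd s) (hw.bd s)))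

lemma ae_of_int_zero (hk : Integrable k) (hv : Dom k v) (hw : Dom k w) {t : ℝ}
    (h : ∫ r in Iic t, ‖v r - w r‖ = 0) : ∀ᵐ s, s ≤ t → v s = w s := by
  rw [integral_eq_zero_iff_of_nonneg (fun _ => norm_nonneg _) (Dom.sub_int hk hv hw).integrableOn] at h
  have := (ae_restrict_iff' measurableSet_Iic).1 h
  filter_upwards [this] with s hs hst
  have := hs hst
  simpa [sub_eq_zero] using this

lemma int_zero_of_ae {t : ℝ} (h : ∀ᵐ s, s ≤ t → v s = w s) :
    ∫ r in Iic t, ‖v r - w r‖ = 0 := by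
  rw [integral_eq_zero_of_ae]
  refine (ae_restrict_iff' measurableSet_Iic).2 ?_
  filter_upwards [h] with s hs hst
  simp [hs hst]

lemma Caus.causal (H : Caus k Γ) (hv : Dom k v) (hw : Dom k w) {t : ℝ}
    (h : ∀ᵐ s, s ≤ t → v s = w s) {s : ℝ} (hs : s ≤ t) : Γ v s = Γ w s := by
  obtain ⟨ε, hε, M, hM, hL⟩ := H.lip w hw t
  have := hL v w hv hw h (Eventually.of_forall fun _ _ => rfl) s (by linarith)
  rw [int_zero_of_ae (h.mono fun r hr hrs => hr (hrs.trans hs)), mul_zero] at this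
  exact sub_eq_zero.1 (norm_le_zero_iff.1 this)

lemma Iic_split {g : ℝ → ℝ} (hg : Integrable g) {a b : ℝ} (hab : a ≤ b) :
    ∫ s in Iic b, g s = (∫ s in Iic a, g s) + ∫ s in Ioc a b, g s := by
  have := intervalIntegral.integral_Iic_sub_Iic (μ := volume) (a := a) (b := b)
    hg.integrableOn hg.integrableOn
  rw [intervalIntegral.integral_of_le hab] at this
  linarith

/-- improved form of the contraction -/
lemma Caus.lip' (H : Caus k Γ) (hv : Dom k v) (t0 : ℝ) : ∃ ε > 0, ∃ M ≥ 0,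
    (M * ∫ s in Ioc t0 (t0 + ε), k s) ≤ 1 / 2 ∧ ∀ w w', Dom k w → Dom k w' →
    (∀ᵐ s, s ≤ t0 → w s = v s) → (∀ᵐ s, s ≤ t0 → w' s = v s) → ∀ s ≤ t0 + ε,
      ‖Γ w s - Γ w' s‖ ≤ M * k s * ∫ r in Iic s, ‖w r - w' r‖ := by
  obtain ⟨ε, hε, M, hM, hL⟩ := H.lip v hv t0
  have hc : Continuous fun t => M * ((∫ s in Iic t, k s) - ∫ s in Iic t0, k s) :=
    continuous_const.mul ((cont_prim H.int).sub continuous_const)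
  have h1 : ∀ᶠ t in 𝓝 t0, M * ((∫ s in Iic t, k s) - ∫ s in Iic t0, k s) < 1 / 2 :=
    hc.continuousAt.eventually_lt continuousAt_const (by simp)
  obtain ⟨δ, hδ, hδ1⟩ := Metric.eventually_nhds_iff.1 h1
  refine ⟨min ε (δ / 2), by positivity, M, hM, ?_, fun w w' a b c d s hs => hL w w' a b c d s
    (hs.trans (by gcongr; exact min_le_left _ _))⟩
  have h2 : 0 < min ε (δ / 2) := by positivity
  have := hδ1 (y := t0 + min ε (δ / 2)) (by
    rw [Real.dist_eq, add_sub_cancel_left, abs_of_pos h2]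
    exact (min_le_right _ _).trans_lt (by linarith))
  rw [Iic_split H.int (by linarith : t0 ≤ t0 + min ε (δ / 2)), add_sub_cancel_left] at this
  exact this.le

/-- fixed up to time t -/
def Fix (Γ : (ℝ → V) → ℝ → V) (t : ℝ) (v : ℝ → V) : Prop := ∀ᵐ s, s ≤ t → v s = Γ v s

lemma Fix.mono {t t' : ℝ} (h : Fix Γ t v) (ht : t' ≤ t) : Fix Γ t' v :=
  Eventually.mono h fun _ hs hst => hs (hst.trans ht)

lemma ae_neg (H : Caus k Γ) (hv : Dom k v) (hw : Dom k w) : ∀ᵐ s, s ≤ 0 → v s = w s := by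
  have h0 : ∀ᵐ s : ℝ, s ≠ 0 := by simp [ae_iff]
  filter_upwards [h0] with s hs hs0
  have h1 := H.neg s (lt_of_le_of_ne hs0 hs)
  have a := hv.bd s
  have b := hw.bd s
  rw [h1] at a b
  rw [norm_le_zero_iff.1 a, norm_le_zero_iff.1 b]

lemma Caus.step (H : Caus k Γ) {t0 t1 : ℝ} {ε M D : ℝ} (_hε : 0 < ε)
    (hMk : (M * ∫ s in Ioc t0 (t0 + ε), k s) ≤ 1 / 2) {g : ℝ → ℝ} (hg : Integrable g) (hM : 0 ≤ M)
    (hk0 : ∀ s, 0 ≤ k s)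
    (h0 : ∫ r in Iic t0, g r = 0) (ht : t0 ≤ t1) (ht1 : t1 ≤ t0 + ε)
    (hD : 0 ≤ D) (hb : ∀ᵐ s, s ∈ Ioc t0 t1 → g s ≤ M * k s * D) :
    ∫ r in Iic t1, g r ≤ 1 / 2 * D := by
  rw [Iic_split hg ht, h0, zero_add]
  have h1 : ∫ s in Ioc t0 t1, g s ≤ ∫ s in Ioc t0 t1, M * k s * D :=
    setIntegral_mono_ae_restrict hg.integrableOn ((H.int.const_mul M).mul_const D).integrableOn
      ((ae_restrict_iff' measurableSet_Ioc).2 hb)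
  refine h1.trans ?_
  rw [integral_mul_const, integral_const_mul]
  refine mul_le_mul_of_nonneg_right (le_trans ?_ hMk) hD
  refine mul_le_mul_of_nonneg_left ?_ hM
  exact setIntegral_mono_set H.int.integrableOn (Eventually.of_forall hk0)
    (Ioc_subset_Ioc_right ht1).eventuallyLE

lemma Caus.unique (H : Caus k Γ) (hv : Dom k v) (hw : Dom k w) {T : ℝ}
    (h1 : Fix Γ T v) (h2 : Fix Γ T w) : ∀ᵐ s, s ≤ T → v s = w s := by
  rcases lt_or_ge T 0 with hT | hT
  · exact (ae_neg H hv hw).mono fun s hs hst => hs (hst.trans hT.le)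
  have hi := Dom.sub_int H.int hv hw
  let S : Set ℝ := {t | ∫ r in Iic t, ‖v r - w r‖ = 0}
  have hS : IsClosed S := isClosed_eq (cont_prim hi) continuous_const
  have key : Icc 0 T ⊆ S := by
    refine (hS.inter isClosed_Icc).Icc_subset_of_forall_mem_nhdsWithin
      (int_zero_of_ae (ae_neg H hv hw)) ?_
    rintro t0 ⟨ht0, ht0'⟩
    have hvw := ae_of_int_zero H.int hv hw ht0
    obtain ⟨ε, hε, M, hM, hMk, hL⟩ := H.lip' hw t0
    have hpos : t0 < min (t0 + ε) T := lt_min (by linarith) ht0'.2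
    filter_upwards [Ioc_mem_nhdsGT hpos] with t ht
    have hD0 : 0 ≤ ∫ r in Iic t, ‖v r - w r‖ := integral_nonneg fun _ => norm_nonneg _
    have := H.step (g := fun r => ‖v r - w r‖) (D := ∫ r in Iic t, ‖v r - w r‖) hε hMk hi hM hv.k0
      ht0 ht.1.le (ht.2.trans (min_le_left _ _)) hD0 (by
        filter_upwards [h1, h2] with s a b hs
        have hsT : s ≤ T := hs.2.trans (ht.2.trans (min_le_right _ _))
        rw [a hsT, b hsT]
        refine (hL v w hv hw hvw (Eventually.of_forall fun _ _ => rfl) s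
          (hs.2.trans (ht.2.trans (min_le_left _ _)))).trans ?_
        exact mul_le_mul_of_nonneg_left (prim_mono hi (fun _ => norm_nonneg _) hs.2)
          (mul_nonneg hM (hv.k0 s)))
    change ∫ r in Iic t, ‖v r - w r‖ = 0
    linarith
  exact ae_of_int_zero H.int hv hw (key ⟨hT, le_rfl⟩)

variable [CompleteSpace V]

open Classical in
lemma Caus.extend (H : Caus k Γ) (hv : Dom k v) {t0 : ℝ} (hf : Fix Γ t0 v) :
    ∃ ε > 0, ∃ w, Dom k w ∧ Fix Γ (t0 + ε) w := by
  obtain ⟨ε, hε, M, hM, hMk, hL⟩ := H.lip' hv t0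
  have hk0 := hv.k0
  let F : (ℝ → V) → ℝ → V := fun w s => if s ≤ t0 then v s else Γ w s
  have hF : ∀ w, Dom k w → Dom k (F w) := by
    intro w hw
    refine ⟨?_, fun s => ?_⟩
    · exact AEStronglyMeasurable.piecewise (s := Iic t0) measurableSet_Iic hv.meas.restrict
        (H.maps w hw).meas.restrict
    · simp only [F]; split_ifs
      · exact hv.bd s
      · exact (H.maps w hw).bd s
  let W : ℕ → ℝ → V := fun n => F^[n] v
  have hWs : ∀ n, W (n + 1) = F (W n) := fun n => Function.iterate_succ_apply' F n v
  have hWd : ∀ n, Dom k (W n) := by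
    intro n
    induction n with
    | zero => exact hv
    | succ n ih => rw [hWs]; exact hF _ ih
  have hWv : ∀ n, ∀ s ≤ t0, W n s = v s := by
    intro n s hs
    cases n with
    | zero => rfl
    | succ n => rw [hWs]; exact if_pos hs
  have hWv' : ∀ n, ∀ᵐ s, s ≤ t0 → W n s = v s := fun n => Eventually.of_forall (hWv n)
  have hi : ∀ n, Integrable fun s => ‖W (n+1) s - W n s‖ := fun n =>
    Dom.sub_int H.int (hWd _) (hWd _)
  let D : ℕ → ℝ := fun n => ∫ r in Iic (t0 + ε), ‖W (n+1) r - W n r‖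
  have hD0 : ∀ n, 0 ≤ D n := fun n => integral_nonneg fun _ => norm_nonneg _
  have hdiff : ∀ n, ∀ s ≤ t0 + ε, ‖W (n+2) s - W (n+1) s‖ ≤ M * k s * D n := by
    intro n s hs
    by_cases hst : s ≤ t0
    · rw [hWv _ s hst, hWv _ s hst, sub_self, norm_zero]
      exact mul_nonneg (mul_nonneg hM (hk0 s)) (hD0 n)
    · have e : ∀ n, W (n+1) s = Γ (W n) s := fun n => by rw [hWs]; exact if_neg hst
      rw [e (n+1), e n]
      refine (hL _ _ (hWd _) (hWd _) (hWv' _) (hWv' _) s hs).trans ?_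
      exact mul_le_mul_of_nonneg_left (prim_mono (hi n) (fun _ => norm_nonneg _) hs)
          (mul_nonneg hM (hk0 s))
  have hDs : ∀ n, D (n+1) ≤ 1 / 2 * D n := by
    intro n
    refine H.step (g := fun r => ‖W (n+2) r - W (n+1) r‖) hε hMk (hi _) hM hk0 ?_
      (by linarith) le_rfl (hD0 n) (Eventually.of_forall fun s hs => hdiff n s hs.2)
    exact int_zero_of_ae (Eventually.of_forall fun s hs => by rw [hWv _ s hs, hWv _ s hs])
  have hDn : ∀ n, D n ≤ D 0 * (1 / 2) ^ n := by
    intro n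
    induction n with
    | zero => simp
    | succ n ih =>
      refine (hDs n).trans ?_
      rw [pow_succ]; linarith
  have hlim : ∀ s, ∃ l, s ≤ t0 + ε → Tendsto (fun n => W n s) atTop (𝓝 l) := by
    intro s
    by_cases hs : s ≤ t0 + ε
    · have hC : CauchySeq fun n => W (n+1) s := by
        refine cauchySeq_of_le_geometric (1/2) (M * k s * D 0) (by norm_num) fun n => ?_
        rw [dist_comm, dist_eq_norm, mul_assoc]
        refine (hdiff n s hs).trans ?_
        exact mul_le_mul_of_nonneg_left (hDn n) (mul_nonneg hM (hk0 s))
      obtain ⟨l, hl⟩ := cauchySeq_tendsto_of_complete hC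
      exact ⟨l, fun _ => (tendsto_add_atTop_iff_nat 1).1 hl⟩
    · exact ⟨0, fun h => absurd h hs⟩
  choose l hl using hlim
  let w : ℝ → V := (Iic (t0 + ε)).indicator l
  have hwl : ∀ s ≤ t0 + ε, Tendsto (fun n => W n s) atTop (𝓝 (w s)) := by
    intro s hs
    simp only [w]; rw [indicator_of_mem (mem_Iic.2 hs)]; exact hl s hs
  have hw : Dom k w := by
    refine ⟨?_, fun s => ?_⟩
    · refine aestronglyMeasurable_of_tendsto_ae atTop (f := fun n => (Iic (t0+ε)).indicator (W n))
        (fun n => (hWd n).meas.indicator measurableSet_Iic) (Eventually.of_forall fun s => ?_)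
      by_cases hs : s ≤ t0 + ε
      · simp only [indicator_of_mem (mem_Iic.2 hs)]; exact hwl s hs
      · have h1 : s ∉ Iic (t0 + ε) := by simpa using hs
        simp only [w, indicator_of_notMem h1]; exact tendsto_const_nhds
    · by_cases hs : s ≤ t0 + ε
      · exact le_of_tendsto (hwl s hs).norm (Eventually.of_forall fun n => (hWd n).bd s)
      · have h1 : s ∉ Iic (t0 + ε) := by simpa using hs
        simp only [w, indicator_of_notMem h1, norm_zero]; exact hk0 s
  have hwv : ∀ s ≤ t0, w s = v s := by
    intro s hs
    refine tendsto_nhds_unique (hwl s (by linarith)) ?_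
    simp only [hWv _ s hs]; exact tendsto_const_nhds
  refine ⟨ε, hε, w, hw, ?_⟩
  filter_upwards [hf] with s hfs hs
  by_cases hst : s ≤ t0
  · rw [hwv s hst, hfs hst]
    exact H.causal hv hw (Eventually.of_forall fun r hr => (hwv r hr).symm) hst
  · have e : ∀ n, W (n+1) s = Γ (W n) s := fun n => by rw [hWs]; exact if_neg hst
    have h1 : Tendsto (fun n => Γ (W n) s) atTop (𝓝 (w s)) := by
      simp only [← e]
      exact (tendsto_add_atTop_iff_nat 1).2 (hwl s hs)
    refine tendsto_nhds_unique h1 (tendsto_iff_norm_sub_tendsto_zero.2 ?_)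
    have h2 : Tendsto (fun n => ∫ r in Iic s, ‖W n r - w r‖) atTop (𝓝 0) := by
      have h0 : (0:ℝ) = ∫ r in Iic s, (0:ℝ) := by simp
      rw [h0]
      refine tendsto_integral_of_dominated_convergence (fun r => k r + k r)
        (fun n => ((hWd n).meas.sub hw.meas).norm.restrict) (H.int.add H.int).integrableOn
        (fun n => Eventually.of_forall fun r => ?_)
        ((ae_restrict_iff' measurableSet_Iic).2 (Eventually.of_forall fun r hr => ?_))
      · rw [norm_norm]; exact (norm_sub_le _ _).trans (add_le_add ((hWd n).bd r) (hw.bd r))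
      · exact tendsto_iff_norm_sub_tendsto_zero.1 (hwl r (le_trans hr hs))
    have h3 := h2.const_mul (M * k s)
    rw [mul_zero] at h3
    exact squeeze_zero (fun n => norm_nonneg _) (fun n => hL _ _ (hWd n) hw (hWv' n)
      (Eventually.of_forall hwv) s hs) h3

open Classical in
lemma Caus.glue (H : Caus k Γ) {t : ℕ → ℝ} (ht : Monotone t) (v : ℕ → ℝ → V)
    (hv : ∀ n, Dom k (v n)) (hf : ∀ n, Fix Γ (t n) (v n)) {a : ℝ} (ha : ∀ s < a, ∃ n, s ≤ t n) :
    ∃ w, Dom k w ∧ Fix Γ a w := by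
  have hc : ∀ᵐ s, ∀ n m, s ≤ t n → s ≤ t m → v n s = v m s := by
    rw [ae_all_iff]; intro n
    rw [ae_all_iff]; intro m
    have h1 := H.unique (T := min (t n) (t m)) (hv n) (hv m) ((hf n).mono (min_le_left _ _))
      ((hf m).mono (min_le_right _ _))
    filter_upwards [h1] with s hs h1 h2 using hs (le_min h1 h2)
  let w : ℝ → V := fun s => if h : ∃ n, s ≤ t n then v (Nat.find h) s else 0
  have hwe : ∀ᵐ s, ∀ n, s ≤ t n → w s = v n s := by
    filter_upwards [hc] with s hs n hn
    have h : ∃ n, s ≤ t n := ⟨n, hn⟩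
    simp only [w]; rw [dif_pos h]
    exact hs _ _ (Nat.find_spec h) hn
  have hw : Dom k w := by
    refine ⟨?_, fun s => ?_⟩
    · refine aestronglyMeasurable_of_tendsto_ae atTop (f := fun n => (Iic (t n)).indicator (v n))
        (fun n => (hv n).meas.indicator measurableSet_Iic) ?_
      filter_upwards [hwe] with s hs
      by_cases h : ∃ n, s ≤ t n
      · obtain ⟨n, hn⟩ := h
        refine tendsto_const_nhds.congr' ?_
        filter_upwards [eventually_ge_atTop n] with m hm
        have : s ≤ t m := hn.trans (ht hm)
        rw [indicator_of_mem (mem_Iic.2 this), hs m this]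
      · have h0 : w s = 0 := dif_neg h
        rw [h0]
        refine tendsto_const_nhds.congr fun n => ?_
        rw [indicator_of_notMem]
        exact fun h1 => h ⟨n, h1⟩
    · simp only [w]; split_ifs with h
      · exact (hv _).bd s
      · rw [norm_zero]; exact (hv 0).k0 s
  refine ⟨w, hw, ?_⟩
  have hne : ∀ᵐ s : ℝ, s ≠ a := by simp [ae_iff]
  have hff : ∀ᵐ s, ∀ n, s ≤ t n → v n s = Γ (v n) s := ae_all_iff.2 hf
  filter_upwards [hwe, hne, hff] with s h1 h2 h3 h4
  obtain ⟨n, hn⟩ := ha s (lt_of_le_of_ne h4 h2)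
  rw [h1 n hn, h3 n hn]
  exact (H.causal hw (hv n) (hwe.mono fun r hr hrn => hr n hrn) hn).symm

lemma Caus.exists (H : Caus k Γ) (hk0 : ∀ s, 0 ≤ k s) (T : ℝ) :
    ∃ w, Dom k w ∧ Fix Γ T w := by
  let S : Set ℝ := {t | ∃ w, Dom k w ∧ Fix Γ t w}
  have hdown : ∀ t ∈ S, ∀ t' ≤ t, t' ∈ S := fun t ⟨w, h1, h2⟩ t' ht => ⟨w, h1, h2.mono ht⟩
  have h0 : (0:ℝ) ∈ S := by
    have : Dom k (fun _ => (0:V)) := ⟨aestronglyMeasurable_const, fun s => by simpa using hk0 s⟩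
    exact ⟨_, this, ae_neg H this (H.maps _ this)⟩
  by_contra hcon
  have hb : BddAbove S := ⟨T, fun t ht => by
    by_contra h
    exact hcon (hdown t ht T (not_le.1 h).le)⟩
  have hlt : ∀ t < sSup S, t ∈ S := by
    intro t ht
    obtain ⟨t', h1, h2⟩ := exists_lt_of_lt_csSup ⟨0, h0⟩ ht
    exact hdown t' h1 t h2.le
  have hmem : sSup S ∈ S := by
    obtain ⟨u, hu, hu1, hu2⟩ := exists_seq_strictMono_tendsto (sSup S)
    choose v h1 h2 using fun n => hlt (u n) (hu1 n)
    exact H.glue hu.monotone v h1 h2 fun s hs =>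
      ((hu2.eventually_const_le hs).exists)
  obtain ⟨w, hw, hfw⟩ := hmem
  obtain ⟨ε, hε, w', hw', hf'⟩ := H.extend hw hfw
  have : sSup S + ε ≤ sSup S := le_csSup hb ⟨w', hw', hf'⟩
  linarith

end FY
end

section
set_option maxSynthPendingDepth 3
set_option linter.unusedSectionVars false
namespace FY
variable {V : Type*} [NormedAddCommGroup V] [InnerProductSpace ℝ V] [CompleteSpace V]

lemma vel_exists (B : V →L[ℝ] V →L[ℝ] ℝ) (hB : ∀ u, 0 ≤ B u u) {ω : ℝ} (hω : 0 < ω)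
    (j : V →L[ℝ] ℝ) : ∃ v, IsVel B ω j v := by
  let I : V →L[ℝ] V →L[ℝ] ℝ := innerSL ℝ
  let C : V →L[ℝ] V →L[ℝ] ℝ := ω • I + B
  have hCa : ∀ u w, C u w = ω * ⟪u, w⟫ + B u w := fun u w => by
    have : I u w = ⟪u, w⟫ := rfl
    simp [C, this]
  have hC : IsCoercive C := ⟨ω, hω, fun u => by
    rw [hCa, real_inner_self_eq_norm_mul_norm, mul_assoc]; linarith [hB u]⟩
  refine ⟨hC.continuousLinearEquivOfBilin.symm ((InnerProductSpace.toDual ℝ V).symm j), fun w => ?_⟩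
  rw [← hCa, ← hC.continuousLinearEquivOfBilin_apply]
  simp

lemma vel_bound {B : V →L[ℝ] V →L[ℝ] ℝ} (hB : ∀ u, 0 ≤ B u u) {ω : ℝ} (hω : 0 < ω)
    {j : V →L[ℝ] ℝ} {v : V} (h : IsVel B ω j v) : ‖v‖ ≤ ‖j‖ / ω := by
  rw [le_div_iff₀ hω]
  have h1 := h v
  rw [real_inner_self_eq_norm_mul_norm] at h1
  have h2 : j v ≤ ‖j‖ * ‖v‖ := (le_abs_self _).trans (j.le_opNorm v)
  by_cases hv : ‖v‖ = 0
  · rw [hv]; simp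
  · have hv' : 0 < ‖v‖ := lt_of_le_of_ne (norm_nonneg _) (Ne.symm hv)
    have := hB v
    refine le_of_mul_le_mul_right ?_ hv'
    nlinarith

lemma vel_diff {B B' : V →L[ℝ] V →L[ℝ] ℝ} (hB : ∀ u, 0 ≤ B u u) {ω : ℝ} (hω : 0 < ω)
    {j j' : V →L[ℝ] ℝ} {v v' : V} (h : IsVel B ω j v) (h' : IsVel B' ω j' v') :
    ‖v - v'‖ ≤ (‖j - j'‖ + ‖B - B'‖ * ‖v'‖) / ω := by
  have h1 : IsVel B ω (j - j' - (B - B') v') (v - v') := by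
    intro w
    have a := h w
    have b := h' w
    simp only [inner_sub_left, map_sub, sub_apply]
    linarith
  refine (vel_bound hB hω h1).trans (div_le_div_of_nonneg_right ?_ hω.le)
  exact (norm_sub_le _ _).trans (add_le_add le_rfl ((B - B').le_opNorm v'))

open Classical in
/-- the resolvent -/
def Rv (ω : ℝ) (B : V →L[ℝ] V →L[ℝ] ℝ) (j : V →L[ℝ] ℝ) : V :=
  if h : ∃ v, IsVel B ω j v then h.choose else 0

lemma Rv_spec {B : V →L[ℝ] V →L[ℝ] ℝ} (hB : ∀ u, 0 ≤ B u u) {ω : ℝ} (hω : 0 < ω)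
    (j : V →L[ℝ] ℝ) : IsVel B ω j (Rv ω B j) := by
  have h := vel_exists B hB hω j
  unfold Rv; rw [dif_pos h]; exact h.choose_spec

lemma Rv_unique {B : V →L[ℝ] V →L[ℝ] ℝ} (hB : ∀ u, 0 ≤ B u u) {ω : ℝ} (hω : 0 < ω)
    {j : V →L[ℝ] ℝ} {v : V} (h : IsVel B ω j v) : v = Rv ω B j := by
  have := vel_diff hB hω h (Rv_spec hB hω j)
  simp only [sub_self, norm_zero, zero_mul, add_zero, zero_div, norm_le_zero_iff] at this
  exact sub_eq_zero.1 this

lemma Rv_cont {ω : ℝ} (hω : 0 < ω) :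
    Continuous fun z : {B : V →L[ℝ] V →L[ℝ] ℝ // ∀ u, 0 ≤ B u u} × (V →L[ℝ] ℝ) =>
      Rv ω z.1.1 z.2 := by
  refine continuous_iff_continuousAt.2 fun z0 => tendsto_iff_norm_sub_tendsto_zero.2 ?_
  have h1 : Continuous fun z : {B : V →L[ℝ] V →L[ℝ] ℝ // ∀ u, 0 ≤ B u u} × (V →L[ℝ] ℝ) =>
      (‖z.2 - z0.2‖ + ‖z.1.1 - z0.1.1‖ * ‖Rv ω z0.1.1 z0.2‖) / ω :=
    ((((continuous_snd.sub continuous_const).norm).add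
      ((((continuous_subtype_val.comp continuous_fst).sub continuous_const).norm).mul
        continuous_const)).div_const ω)
  have h2 := h1.tendsto z0
  simp only [sub_self, norm_zero, zero_mul, add_zero, zero_div] at h2
  exact squeeze_zero (fun _ => norm_nonneg _) (fun z =>
    vel_diff z.1.2 hω (Rv_spec z.1.2 hω z.2) (Rv_spec z0.1.2 hω z0.2)) h2

lemma Rv_meas {ω : ℝ} (hω : 0 < ω) {a : ℝ → V →L[ℝ] V →L[ℝ] ℝ} (ha : Continuous a)
    (hpos : ∀ s u, 0 ≤ a s u u) {j : ℝ → V →L[ℝ] ℝ} (hj : AEStronglyMeasurable j volume) :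
    AEStronglyMeasurable (fun s => Rv ω (a s) (j s)) volume := by
  have h1 : Continuous fun s => (⟨a s, hpos s⟩ : {B : V →L[ℝ] V →L[ℝ] ℝ // ∀ u, 0 ≤ B u u}) :=
    ha.subtype_mk _
  have h2 := h1.aestronglyMeasurable (μ := volume)
  exact FD.meas_aux (G := fun (B : {B : V →L[ℝ] V →L[ℝ] ℝ // ∀ u, 0 ≤ B u u}) j => Rv ω B.1 j)
    (Rv_cont hω) h2 hj

/-- hypothesis on the operators -/
structure AOK (A : DiffId 1 → V →L[ℝ] V →L[ℝ] ℝ) : Prop where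
  pos : ∀ (φ : DiffId 1) (u : V), 0 ≤ A φ u u
  lip : ∀ φ₀ : DiffId 1, ∃ r > 0, ∃ ℓ > 0, ∀ φ ψ : DiffId 1,
      distS 1 φ φ₀ ≤ r → distS 1 ψ φ₀ ≤ r → ‖A φ - A ψ‖ ≤ ℓ * distS 1 φ ψ

lemma distS_nonneg (φ ψ : DiffId 1) : 0 ≤ distS 1 φ ψ := normS_nonneg _ _
lemma distS_self (φ : DiffId 1) : distS 1 φ φ = 0 := by
  refine le_antisymm ?_ (distS_nonneg _ _)
  have := normS1_le (w := fun x => φ x - φ x) (p := fun _ => 0) (a := 0) (b := 0)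
    (fun x => by simpa using hasFDerivAt_const (0:E3) x) (by simp) (by simp)
  simpa [distS] using this

lemma AOK.cont {A : DiffId 1 → V →L[ℝ] V →L[ℝ] ℝ} (hA : AOK A) {Φ : ℝ → DiffId 1}
    (h : ∀ t0, Tendsto (fun t => distS 1 (Φ t) (Φ t0)) (𝓝 t0) (𝓝 0)) :
    Continuous fun t => A (Φ t) := by
  refine continuous_iff_continuousAt.2 fun t0 => tendsto_iff_norm_sub_tendsto_zero.2 ?_
  obtain ⟨r, hr, ℓ, hℓ, hL⟩ := hA.lip (Φ t0)
  have h1 := (h t0).const_mul ℓ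
  rw [mul_zero] at h1
  refine squeeze_zero' (Eventually.of_forall fun _ => norm_nonneg _) ?_ h1
  filter_upwards [(h t0).eventually_le_const hr] with t ht
  exact hL _ _ ht (by rw [distS_self]; exact hr.le)

end FY
end

section
set_option maxSynthPendingDepth 3
set_option linter.unusedSectionVars false
namespace FY
variable {V : Type*} [NormedAddCommGroup V] [InnerProductSpace ℝ V] [CompleteSpace V]
variable {emb : V →ₗ[ℝ] (E3 → E3)} {cV ω : ℝ} {A : DiffId 1 → V →L[ℝ] V →L[ℝ] ℝ}
  {j : ℝ → V →L[ℝ] ℝ} {k : ℝ → ℝ} {v w : ℝ → V} {Φ Ψ : ℝ → DiffId 1}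

lemma normS_comm (s : ℕ) (f g : E3 → E3) :
    normS s (fun x => f x - g x) = normS s (fun x => g x - f x) := by
  have : (fun x => f x - g x) = -(fun x => g x - f x) := by ext1 x; simp
  rw [this]
  unfold normS supDeriv
  simp only [iteratedFDeriv_neg, Pi.neg_apply, norm_neg]

lemma Dom.adm (h : EmbOK emb cV) (hk : Integrable k) (hneg : ∀ s < 0, k s = 0) (hv : Dom k v) :
    Adm cV (fun s => cV * k s) v :=
  ⟨hv.meas, hk.const_mul cV, fun s => mul_le_mul_of_nonneg_left (hv.bd s) h.pos.le, fun s hs => by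
    have := hv.bd s
    rw [hneg s hs] at this
    exact norm_le_zero_iff.1 this⟩

lemma IsFlow.time_abs (H : IsFlow emb v Φ) (hv : Adm cV k v) (h : EmbOK emb cV) (t t0 : ℝ) :
    normS 2 (fun x => Φ t x - Φ t0 x) ≤
      |CT k| * |(∫ s in Iic t, k s) - ∫ s in Iic t0, k s| := by
  rw [← abs_mul]
  rcases le_total t0 t with ht | ht
  · refine le_trans ((H.time hv h ht).trans (le_of_eq ?_)) (le_abs_self _)
    rw [Iic_split hv.int ht]; ring
  · rw [normS_comm, ← abs_neg]
    refine le_trans ((H.time hv h ht).trans (le_of_eq ?_)) (le_abs_self _)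
    rw [Iic_split hv.int ht]; ring

lemma IsFlow.cont2 (H : IsFlow emb v Φ) (hv : Adm cV k v) (h : EmbOK emb cV) (t0 : ℝ) :
    Tendsto (fun t => normS 2 fun x => Φ t x - Φ t0 x) (𝓝 t0) (𝓝 0) := by
  have h1 : Continuous fun t => |CT k| * |(∫ s in Iic t, k s) - ∫ s in Iic t0, k s| :=
    continuous_const.mul ((cont_prim hv.int).sub continuous_const).abs
  have h2 := h1.tendsto t0
  simp only [sub_self, abs_zero, mul_zero] at h2
  exact squeeze_zero (fun _ => normS_nonneg _ _) (fun t => H.time_abs hv h t t0) h2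

lemma IsFlow.cont1 (H : IsFlow emb v Φ) (hv : Adm cV k v) (h : EmbOK emb cV) (t0 : ℝ) :
    Tendsto (fun t => distS 1 (Φ t) (Φ t0)) (𝓝 t0) (𝓝 0) :=
  squeeze_zero (fun _ => distS_nonneg _ _) (fun _ => normS12 _) (H.cont2 hv h t0)

lemma dom_Rv (hA : AOK A) (hω : 0 < ω) (hj : Integrable j)
    (hc : ∀ t0, Tendsto (fun t => distS 1 (Φ t) (Φ t0)) (𝓝 t0) (𝓝 0)) :
    Dom (fun s => ‖j s‖ / ω) (fun s => Rv ω (A (Φ s)) (j s)) :=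
  ⟨Rv_meas hω (hA.cont hc) (fun s => hA.pos _) hj.aestronglyMeasurable,
    fun s => vel_bound (hA.pos _) hω (Rv_spec (hA.pos _) hω _)⟩

lemma caus (h : EmbOK emb cV) (hA : AOK A) (hω : 0 < ω) (hj : Integrable j)
    (hj0 : ∀ s < 0, j s = 0) {Fl : (ℝ → V) → ℝ → DiffId 1}
    (hFl : ∀ v, Dom (fun s => ‖j s‖ / ω) v → IsFlow emb v (Fl v)) :
    Caus (fun s => ‖j s‖ / ω) (fun v s => Rv ω (A (Fl v s)) (j s)) := by
  have hk : Integrable (fun s => ‖j s‖ / ω) := hj.norm.div_const ω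
  have hneg : ∀ s < 0, ‖j s‖ / ω = 0 := fun s hs => by rw [hj0 s hs]; simp
  have adm : ∀ v, Dom (fun s => ‖j s‖ / ω) v → Adm cV (fun s => cV * (‖j s‖ / ω)) v :=
    fun v hv => hv.adm h hk hneg
  refine ⟨hk, hneg, fun v hv => dom_Rv hA hω hj ((hFl v hv).cont1 (adm v hv) h), ?_⟩
  intro v hv t0
  set K : ℝ → ℝ := fun s => cV * (‖j s‖ / ω) with hK
  obtain ⟨r, hr, ℓ, hℓ, hL⟩ := hA.lip (Fl v t0)
  have h1 : Continuous fun t => |CT K| * |(∫ s in Iic t, K s) - ∫ s in Iic t0, K s| :=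
    continuous_const.mul ((cont_prim (adm v hv).int).sub continuous_const).abs
  have h2 := h1.tendsto t0
  simp only [sub_self, abs_zero, mul_zero] at h2
  obtain ⟨δ, hδ, hδ1⟩ := Metric.eventually_nhds_iff.1 (h2.eventually_le_const hr)
  refine ⟨δ / 2, by positivity, ℓ * (|CD K| * cV) / ω,
    by have := h.pos; positivity, fun w w' hw hw' e e' s hs => ?_⟩
  have hI := Dom.sub_int hk hw hw'
  have hI0 : 0 ≤ ∫ r in Iic s, ‖w r - w' r‖ := integral_nonneg fun _ => norm_nonneg _
  rcases le_total s t0 with hst | hst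
  · have : Fl w s = Fl w' s := by
      refine (hFl w hw).eq_of_ae (adm w hw) (hFl w' hw') h ?_
      filter_upwards [e, e'] with s' a b hs'
      rw [a (hs'.trans hst), b (hs'.trans hst)]
    simp only [this, sub_self, norm_zero]
    have := h.pos; positivity
  · have near : ∀ u, Dom (fun s => ‖j s‖ / ω) u → (∀ᵐ s, s ≤ t0 → u s = v s) →
        distS 1 (Fl u s) (Fl v t0) ≤ r := by
      intro u hu hue
      rw [← (hFl u hu).eq_of_ae (adm u hu) (hFl v hv) h hue]
      refine le_trans (normS12 _) (((hFl u hu).time_abs (adm u hu) h s t0).trans (hδ1 ?_))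
      rw [Real.dist_eq, abs_of_nonneg (by linarith)]; linarith
    have hd := (hFl w hw).dist (adm w hw) (hFl w' hw') (adm w' hw') h (t := s)
      (d := fun s => cV * ‖w s - w' s‖) (hI.const_mul cV)
      (fun s => mul_nonneg h.pos.le (norm_nonneg _)) (Eventually.of_forall fun _ _ => le_rfl)
    rw [integral_const_mul] at hd
    have hA1 := hL _ _ (near w hw e) (near w' hw' e')
    have hd2 : distS 1 (Fl w s) (Fl w' s) ≤ |CD K| * (cV * ∫ r in Iic s, ‖w r - w' r‖) :=
      hd.trans (mul_le_mul_of_nonneg_right (le_abs_self _) (mul_nonneg h.pos.le hI0))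
    have hv1 := vel_diff (hA.pos (Fl w s)) hω (Rv_spec (hA.pos (Fl w s)) hω (j s))
      (Rv_spec (hA.pos (Fl w' s)) hω (j s))
    refine hv1.trans ?_
    have hb := vel_bound (hA.pos (Fl w' s)) hω (Rv_spec (hA.pos (Fl w' s)) hω (j s))
    rw [sub_self, norm_zero, zero_add]
    have : ‖A (Fl w s) - A (Fl w' s)‖ * ‖Rv ω (A (Fl w' s)) (j s)‖ ≤
        (ℓ * (|CD K| * (cV * ∫ r in Iic s, ‖w r - w' r‖))) * (‖j s‖ / ω) := by
      refine mul_le_mul (hA1.trans (mul_le_mul_of_nonneg_left hd2 hℓ.le)) hb (norm_nonneg _) ?_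
      have := h.pos; positivity
    refine (div_le_div_of_nonneg_right this hω.le).trans (le_of_eq ?_)
    ring

lemma exists_Fl (h : EmbOK emb cV) (hk : Integrable k) (hk0 : ∀ s, 0 ≤ k s)
    (hneg : ∀ s < 0, k s = 0) : ∃ Fl : (ℝ → V) → ℝ → DiffId 1,
      ∀ v, Dom k v → IsFlow emb v (Fl v) := by
  have : ∀ v, ∃ F : ℝ → DiffId 1, Dom k v → IsFlow emb v F := by
    intro v
    by_cases hv : Dom k v
    · obtain ⟨F, hF⟩ := (hv.adm h hk hneg).exists_flow h
      exact ⟨F, fun _ => hF⟩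
    · have h0 : Dom k (fun _ => (0:V)) := ⟨aestronglyMeasurable_const, fun s => by simpa using hk0 s⟩
      obtain ⟨F, hF⟩ := (h0.adm h hk hneg).exists_flow h
      exact ⟨F, fun h => absurd h hv⟩
  choose Fl hFl using this
  exact ⟨Fl, hFl⟩

/-- curves through the half line integral are the same as curves from zero -/
lemma Iic_eq_interval {g : ℝ → E3} (hg0 : ∀ s < 0, g s = 0) (hg : Integrable g) (t : ℝ) :
    ∫ s in Iic t, g s = ∫ s in (0:ℝ)..t, g s := by
  have : ∫ s in Iic (0:ℝ), g s = 0 := by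
    rw [integral_Iic_eq_integral_Iio]
    exact setIntegral_eq_zero_of_forall_eq_zero fun s hs => hg0 s hs
  rw [← intervalIntegral.integral_Iic_sub_Iic hg.integrableOn hg.integrableOn, this, sub_zero]

end FY
end

section
set_option maxSynthPendingDepth 3
set_option linter.unusedSectionVars false
namespace FY
variable {V : Type*} [NormedAddCommGroup V] [InnerProductSpace ℝ V] [CompleteSpace V]
variable {emb : V →ₗ[ℝ] (E3 → E3)} {cV ω T : ℝ} {A : DiffId 1 → V →L[ℝ] V →L[ℝ] ℝ}
  {j : ℝ → V →L[ℝ] ℝ} {v' : ℝ → V} {φ' : ℝ → DiffId 1}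

/-- clamping to the interval -/
def clp (T t : ℝ) : ℝ := max 0 (min t T)

lemma clp_mem (hT : 0 < T) (t : ℝ) : clp T t ∈ Icc 0 T :=
  ⟨le_max_left _ _, max_le hT.le (min_le_right _ _)⟩
lemma clp_of_mem {t : ℝ} (ht : t ∈ Icc 0 T) : clp T t = t := by
  unfold clp; rw [min_eq_left ht.2, max_eq_right ht.1]
lemma clp_cont (T : ℝ) : Continuous (clp T) := continuous_const.max (continuous_id.min continuous_const)

lemma Rv_zero {B : V →L[ℝ] V →L[ℝ] ℝ} (hB : ∀ u, 0 ≤ B u u) (hω : 0 < ω) : Rv ω B 0 = 0 :=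
  (Rv_unique hB hω (v := 0) (fun w => by simp)).symm

lemma sol_flow (h : EmbOK emb cV) (hA : AOK A) (hω : 0 < ω) (hT : 0 < T)
    (hj : IntegrableOn j (Icc 0 T)) (hs : IsSolution emb ω A j T φ' v') :
    Dom (fun s => ‖(Icc 0 T).indicator j s‖ / ω)
      (fun s => Rv ω (A (φ' (clp T s))) ((Icc 0 T).indicator j s)) ∧
    ∀ Ψ : ℝ → DiffId 1,
      IsFlow emb (fun s => Rv ω (A (φ' (clp T s))) ((Icc 0 T).indicator j s)) Ψ →
      ∀ t, φ' (clp T t) = Ψ t := by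
  set J := (Icc 0 T).indicator j with hJ
  have hJi : Integrable J := hj.integrable_indicator measurableSet_Icc
  have hc : ∀ t0, Tendsto (fun t => distS 1 (φ' (clp T t)) (φ' (clp T t0))) (𝓝 t0) (𝓝 0) :=
    fun t0 => (hs.2.2 (clp T t0) (clp_mem hT t0)).comp (tendsto_nhdsWithin_iff.2
      ⟨(clp_cont T).tendsto t0, Eventually.of_forall fun t => clp_mem hT t⟩)
  have hD := dom_Rv (Φ := fun t => φ' (clp T t)) hA hω hJi hc
  have hneg : ∀ s < 0, ‖J s‖ / ω = 0 := fun s hs => by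
    rw [hJ, indicator_of_notMem (fun h => absurd h.1 (not_le.2 hs))]; simp
  refine ⟨hD, fun Ψ hΨ t => ?_⟩
  obtain ⟨P, Q, H⟩ := hΨ
  have hvf := (hD.adm h (hJi.norm.div_const ω) hneg).vf h
  refine DiffId.ext' fun x => ?_
  have hg : (fun s => emb (Rv ω (A (φ' (clp T s))) (J s)) (φ' (clp T s) x)) =
      (Icc 0 T).indicator (fun s => emb (v' s) (φ' s x)) := by
    ext1 s
    by_cases hsm : s ∈ Icc 0 T
    · rw [indicator_of_mem hsm, hJ, indicator_of_mem hsm, clp_of_mem hsm,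
        ← Rv_unique (hA.pos _) hω (hs.1 s hsm)]
    · rw [indicator_of_notMem hsm, hJ, indicator_of_notMem hsm, Rv_zero (hA.pos _) hω, map_zero]
      rfl
  have hgi : Integrable (fun s => emb (Rv ω (A (φ' (clp T s))) (J s)) (φ' (clp T s) x)) := by
    rw [hg, integrable_indicator_iff measurableSet_Icc]
    exact (intervalIntegrable_iff_integrableOn_Icc_of_le hT.le).1 (hs.2.1 T ⟨hT.le, le_rfl⟩ x).1
  have heq : ∀ t, φ' (clp T t) x =
      x + ∫ s in Iic t, emb (Rv ω (A (φ' (clp T s))) (J s)) (φ' (clp T s) x) := by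
    intro t
    rw [(hs.2.1 _ (clp_mem hT t) x).2, hg, setIntegral_indicator measurableSet_Icc]
    congr 1
    rw [intervalIntegral.integral_of_le (clp_mem hT t).1, ← integral_Icc_eq_integral_Ioc]
    rcases lt_or_ge t 0 with ht | ht
    · have e1 : clp T t = 0 := max_eq_left ((min_le_left _ _).trans ht.le)
      have e2 : Iic t ∩ Icc 0 T = ∅ := by
        ext s; simp only [mem_inter_iff, mem_Iic, mem_Icc, mem_empty_iff_false, iff_false]
        rintro ⟨a, b, -⟩; linarith
      rw [e1, e2]; simp
    · have e2 : Iic t ∩ Icc 0 T = Icc 0 (clp T t) := by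
        ext s
        simp only [mem_inter_iff, mem_Iic, mem_Icc]
        unfold clp
        rw [max_eq_right (le_min ht hT.le), le_min_iff]
        tauto
      rw [e2]
  have hcrv : IsCrv (fun s => emb (Rv ω (A (φ' (clp T s))) (J s))) x (fun t => φ' (clp T t) x) := by
    refine ⟨?_, ?_, hgi, heq⟩
    · rw [funext heq]
      exact continuous_const.add (cont_prim hgi)
    · refine ⟨‖x‖ + ∫ s, ‖emb (Rv ω (A (φ' (clp T s))) (J s)) (φ' (clp T s) x)‖, fun t => ?_⟩
      rw [heq]
      refine (norm_add_le _ _).trans (add_le_add le_rfl ?_)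
      refine (norm_integral_le_integral_norm _).trans ?_
      exact setIntegral_le_integral hgi.norm (Eventually.of_forall fun s => norm_nonneg _)
  have := cmp0 (d := fun _ => 0) (t := t) hvf hcrv (H.c0 x) (by simp) (by simp)
      (Eventually.of_forall fun s hst x => by rw [sub_self, norm_zero])
  simp only [sub_self, norm_zero, integral_zero, add_zero, mul_zero, norm_le_zero_iff] at this
  exact sub_eq_zero.1 this

theorem main (h : EmbOK emb cV) (hA : AOK A) (hω : 0 < ω) (hT : 0 < T)
    (hj : IntegrableOn j (Icc 0 T)) :
    ∃ (φ : ℝ → DiffId 1) (v : ℝ → V),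
      IsSolution emb ω A j T φ v ∧
      (∀ (φ' : ℝ → DiffId 1) (v' : ℝ → V), IsSolution emb ω A j T φ' v' →
        ∀ t ∈ Icc (0 : ℝ) T, ∀ x : E3, φ' t x = φ t x) ∧
      (∀ t ∈ Icc (0 : ℝ) T, MemC0 2 fun x => φ t x - x) ∧
      ∀ t₀ ∈ Icc (0 : ℝ) T,
        Tendsto (fun t => normS 2 fun x => φ t x - φ t₀ x)
          (𝓝[Icc (0 : ℝ) T] t₀) (𝓝 0) := by
  obtain ⟨J, hJ⟩ : ∃ J, J = (Icc 0 T).indicator j := ⟨_, rfl⟩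
  have hJi : Integrable J := by rw [hJ]; exact hj.integrable_indicator measurableSet_Icc
  have hJm : ∀ s ∈ Icc 0 T, J s = j s := fun s hs => by rw [hJ, indicator_of_mem hs]
  have hJ0 : ∀ s < 0, J s = 0 := fun s hs => by
    rw [hJ, indicator_of_notMem (fun h => absurd h.1 (not_le.2 hs))]
  have hk : Integrable (fun s => ‖J s‖ / ω) := hJi.norm.div_const ω
  have hk0 : ∀ s, 0 ≤ ‖J s‖ / ω := fun s => by positivity
  have hneg : ∀ s < 0, ‖J s‖ / ω = 0 := fun s hs => by rw [hJ0 s hs]; simp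
  obtain ⟨Fl, hFl⟩ := exists_Fl h hk hk0 hneg
  have hC := caus h hA hω hJi hJ0 hFl
  obtain ⟨v0, hv0, hfix⟩ := hC.exists hk0 T
  have had := hv0.adm h hk hneg
  have hF := hFl v0 hv0
  refine ⟨Fl v0, fun s => Rv ω (A (Fl v0 s)) (J s), ⟨fun t ht => ?_, fun t ht x => ?_, fun t0 _ =>
    (hF.cont1 had h t0).mono_left nhdsWithin_le_nhds⟩, ?_, fun t _ => hF.memC0 had h t,
    fun t0 _ => (hF.cont2 had h t0).mono_left nhdsWithin_le_nhds⟩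
  · rw [← hJm t ht]; exact Rv_spec (hA.pos _) hω _
  · obtain ⟨P, Q, H⟩ := hF
    have hc := H.c0 x
    have hi := hc.int
    have ha : ∀ᵐ s, s ∈ Set.uIoc 0 t → emb (v0 s) (Fl v0 s x) =
        emb (Rv ω (A (Fl v0 s)) (J s)) (Fl v0 s x) := by
      filter_upwards [hfix] with s hs hst
      rw [uIoc_of_le ht.1] at hst
      rw [← hs (hst.2.trans ht.2)]
    have hi2 : IntervalIntegrable (fun s => emb (v0 s) (Fl v0 s x)) volume 0 t :=
      hi.intervalIntegrable
    refine ⟨hi2.congr_ae ((ae_restrict_iff' measurableSet_uIoc).2 ha), ?_⟩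
    rw [← intervalIntegral.integral_congr_ae ha]
    rw [← Iic_eq_interval (fun s hs => by rw [had.supp s hs, map_zero]; rfl) hi]
    exact hc.eq t
  · intro φ' v' hs t ht x
    obtain ⟨hD, hfl⟩ := sol_flow h hA hω hT hj hs
    rw [← hJ] at hD hfl
    have hflw := hFl _ hD
    have he := hfl _ hflw
    have hfix' : Fix (fun v s => Rv ω (A (Fl v s)) (J s)) T
        (fun s => Rv ω (A (φ' (clp T s))) (J s)) :=
      Eventually.of_forall fun s _ => by
        show Rv ω (A (φ' (clp T s))) (J s) = _
        rw [he s]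
    have hae := hC.unique hD hv0 hfix' hfix
    have e2 := hflw.eq_of_ae (hD.adm h hk hneg) hF (t := t) h
      (hae.mono fun s a b => a (b.trans ht.2))
    rw [← e2, ← he t, clp_of_mem ht]

end FY
end

/-- **Theorem 3.1(i) (free yank model: long-time existence and uniqueness).**
If `φ ↦ A_φ` is symmetric, nonnegative and locally Lipschitz for `‖·‖_{1,∞}` and
`j ∈ L¹([0,T],V*)`, then the control system has a unique solution on `[0,T]`, and
this solution is a continuous map from `[0,T]` into `Diff_id²(ℝ³)`. -/
theorem free_yank_existence_uniqueness
    {V : Type*} [NormedAddCommGroup V] [InnerProductSpace ℝ V] [CompleteSpace V]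
    [TopologicalSpace.SeparableSpace V]
    (emb : V →ₗ[ℝ] (E3 → E3)) (cV : ℝ) (hcV : 0 < cV)
    (hembC0 : ∀ u : V, MemC0 2 (emb u))
    (hembBound : ∀ u : V, normS 2 (emb u) ≤ cV * ‖u‖)
    (ω : ℝ) (hω : 0 < ω)
    (A : DiffId 1 → V →L[ℝ] V →L[ℝ] ℝ)
    (hAsymm : ∀ (φ : DiffId 1) (u w : V), A φ u w = A φ w u)
    (hApos : ∀ (φ : DiffId 1) (u : V), 0 ≤ A φ u u)
    (hAlip : ∀ φ₀ : DiffId 1, ∃ r > 0, ∃ ℓ > 0, ∀ φ ψ : DiffId 1,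
      distS 1 φ φ₀ ≤ r → distS 1 ψ φ₀ ≤ r → ‖A φ - A ψ‖ ≤ ℓ * distS 1 φ ψ)
    (T : ℝ) (hT : 0 < T)
    (j : ℝ → V →L[ℝ] ℝ) (hj : IntegrableOn j (Icc 0 T)) :
    ∃ (φ : ℝ → DiffId 1) (v : ℝ → V),
      IsSolution emb ω A j T φ v ∧
      (∀ (φ' : ℝ → DiffId 1) (v' : ℝ → V), IsSolution emb ω A j T φ' v' →
        ∀ t ∈ Icc (0 : ℝ) T, ∀ x : E3, φ' t x = φ t x) ∧
      (∀ t ∈ Icc (0 : ℝ) T, MemC0 2 fun x => φ t x - x) ∧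
      ∀ t₀ ∈ Icc (0 : ℝ) T,
        Tendsto (fun t => normS 2 fun x => φ t x - φ t₀ x)
          (𝓝[Icc (0 : ℝ) T] t₀) (𝓝 0) := by
  exact FY.main ⟨hcV, hembC0, hembBound⟩ ⟨hApos, hAlip⟩ hω hT hj

end
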